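/- arXiv:1307.1629 — 14 statements merged into one kernel-verified Lean document; each statement's English description precedes it below -/
import Mathlib

section
/- Let (g, ω) be a symplectic Lie algebra over a field k of characteristic 0 and let ∇ : g × g → g be the (unique) bilinear map satisfying ω(∇_u v, w) = −ω(v, [u, w]) for all u, v, w ∈ g. Then ∇ is torsion-free, i.e. ∇_u v − ∇_v u = [u, v] for all u, v ∈ g, and flat, i.e. ∇_{[u,v]} w = ∇_u (∇_v w) − ∇_v (∇_u w) for all u, v, w ∈ g. -/
/-- For a symplectic Lie algebra `(g, ω)`, the bilinear map `∇` defined by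
`ω (∇_u v) w = - ω v ⁅u, w⁆` is torsion-free and flat. -/
theorem stmt_1 {k : Type*} [Field k] [CharZero k]
    {g : Type*} [LieRing g] [LieAlgebra k g] [Module.Finite k g]
    (ω : g →ₗ[k] g →ₗ[k] k)
    (halt : ∀ u : g, ω u u = 0)
    (hnondeg : ∀ u : g, (∀ v : g, ω u v = 0) → u = 0)
    (hclosed : ∀ u v w : g, ω ⁅u, v⁆ w + ω ⁅w, u⁆ v + ω ⁅v, w⁆ u = 0)
    (nabla : g →ₗ[k] g →ₗ[k] g)
    (hnabla : ∀ u v w : g, ω (nabla u v) w = - ω v ⁅u, w⁆) :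
    (∀ u v : g, nabla u v - nabla v u = ⁅u, v⁆) ∧
    (∀ u v w : g, nabla ⁅u, v⁆ w = nabla u (nabla v w) - nabla v (nabla u w)) := by
  have hskew : ∀ u v : g, ω u v = - ω v u := fun u v =>
    (LinearMap.IsAlt.neg (B := ω) halt v u).symm
  refine ⟨fun u v => ?_, fun u v w => ?_⟩
  · refine sub_eq_zero.mp (hnondeg _ fun w => ?_)
    simp only [map_sub, LinearMap.sub_apply, hnabla]
    rw [← lie_skew u w, map_neg, hskew v, hskew u]
    linear_combination -hclosed u v w
  · refine sub_eq_zero.mp (hnondeg _ fun x => ?_)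
    simp only [map_sub, LinearMap.sub_apply, hnabla, lie_lie]
    ring
end

section
/- Let (g, ω) be a symplectic Lie algebra over a field k of characteristic 0 and let ∇ be the bilinear map on g determined by ω(∇_u v, w) = −ω(v, [u, w]) for all u, v, w ∈ g. Then: (1) a Lie subalgebra l of g is totally geodesic with respect to ∇ (i.e. ∇_u v ∈ l for all u, v ∈ l) if and only if [l, l^⊥] ⊆ l^⊥; (2) for every Lie ideal i of g, the orthogonal i^⊥ is a totally geodesic subalgebra; (3) every isotropic Lie ideal j of (g, ω) is a totally geodesic subalgebra and the induced connection on j is trivial, i.e. ∇_u v = 0 for all u, v ∈ j; (4) every Lagrangian subalgebra of (g, ω) is totally geodesic. -/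
/-- For a symplectic Lie algebra `(g, ω)` with canonical connection `∇`
(defined by `ω (∇_u v) w = - ω v ⁅u, w⁆`):
(1) a Lie subalgebra `l` is totally geodesic iff `[l, l^⊥] ⊆ l^⊥`;
(2) for any Lie ideal `i`, the orthogonal `i^⊥` is a totally geodesic subalgebra;
(3) any isotropic Lie ideal `j` is totally geodesic with trivial induced connection;
(4) any Lagrangian subalgebra is totally geodesic. -/
theorem stmt_2 {k : Type*} [Field k] [CharZero k]
    {g : Type*} [LieRing g] [LieAlgebra k g] [Module.Finite k g]
    (ω : g →ₗ[k] g →ₗ[k] k)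
    (halt : ∀ u : g, ω u u = 0)
    (hnondeg : ∀ u : g, (∀ v : g, ω u v = 0) → u = 0)
    (hclosed : ∀ u v w : g, ω ⁅u, v⁆ w + ω ⁅w, u⁆ v + ω ⁅v, w⁆ u = 0)
    (nabla : g →ₗ[k] g →ₗ[k] g)
    (hnabla : ∀ u v w : g, ω (nabla u v) w = - ω v ⁅u, w⁆) :
    (∀ l : LieSubalgebra k g,
      ((∀ u ∈ l, ∀ v ∈ l, nabla u v ∈ l) ↔
        (∀ u ∈ l, ∀ x : g, (∀ y ∈ l, ω x y = 0) → ∀ y ∈ l, ω ⁅u, x⁆ y = 0))) ∧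
    (∀ i : LieIdeal k g, ∀ u v : g,
      (∀ a ∈ i, ω u a = 0) → (∀ a ∈ i, ω v a = 0) →
      ((∀ a ∈ i, ω ⁅u, v⁆ a = 0) ∧ (∀ a ∈ i, ω (nabla u v) a = 0))) ∧
    (∀ j : LieIdeal k g, (∀ x ∈ j, ∀ y ∈ j, ω x y = 0) →
      ∀ u ∈ j, ∀ v ∈ j, nabla u v = 0) ∧
    (∀ l : LieSubalgebra k g, (∀ x ∈ l, ∀ y ∈ l, ω x y = 0) →
      2 * Module.finrank k l.toSubmodule = Module.finrank k g →
      ∀ u ∈ l, ∀ v ∈ l, nabla u v ∈ l) := by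
  have hsymm : ∀ x y : g, ω x y = - ω y x := fun x y ↦ (LinearMap.IsAlt.neg halt y x).symm
  let B : LinearMap.BilinForm k g := ω
  have hrefl : B.IsRefl := LinearMap.IsAlt.isRefl halt
  have hB : B.Nondegenerate := hrefl.nondegenerate_iff_separatingLeft.mpr hnondeg
  have hmem_orth : ∀ (l : Submodule k g) (x : g), x ∈ B.orthogonal l ↔ ∀ y ∈ l, ω x y = 0 :=
    fun l x ↦ forall₂_congr fun y _ ↦ ⟨fun h ↦ hrefl y x h, fun h ↦ hrefl x y h⟩
  have hgeodesic : ∀ l : LieSubalgebra k g,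
      ((∀ u ∈ l, ∀ v ∈ l, nabla u v ∈ l) ↔
        (∀ u ∈ l, ∀ x : g, (∀ y ∈ l, ω x y = 0) → ∀ y ∈ l, ω ⁅u, x⁆ y = 0)) := by
    intro l
    constructor
    · intro h u hu x hx y hy
      rw [hsymm, ← hnabla, hsymm, hx _ (h u hu y hy), neg_zero]
    · intro h u hu v hv
      rw [← LieSubalgebra.mem_toSubmodule,
        ← LinearMap.BilinForm.orthogonal_orthogonal hB hrefl l.toSubmodule, hmem_orth]
      intro x hx
      rw [hnabla, ← hsymm]
      exact h u hu x ((hmem_orth _ _).mp hx) v hv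
  refine ⟨hgeodesic, fun i u v hu hv ↦ ⟨fun a ha ↦ ?_, fun a ha ↦ ?_⟩, ?_, ?_⟩
  · have h := hclosed u v a
    rwa [hsymm ⁅a, u⁆, hsymm ⁅v, a⁆, hv _ (lie_mem_left k g i a u ha),
      hu _ (lie_mem_right k g i v a ha), neg_zero, add_zero, add_zero] at h
  · rw [hnabla, hv _ (lie_mem_right k g i u a ha), neg_zero]
  · intro j hj u hu v hv
    refine hnondeg _ fun w ↦ ?_
    rw [hnabla, hj v hv _ (lie_mem_left k g j u w hu), neg_zero]
  · intro l hl hdim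
    have hle : l.toSubmodule ≤ B.orthogonal l.toSubmodule :=
      fun x hx ↦ (hmem_orth _ _).mpr (hl x hx)
    have heq : l.toSubmodule = B.orthogonal l.toSubmodule := by
      refine Submodule.eq_of_le_of_finrank_eq hle ?_
      rw [LinearMap.BilinForm.finrank_orthogonal hB]
      lia
    refine (hgeodesic l).mpr fun u hu x hx y hy ↦ hl _ (l.lie_mem hu ?_) y hy
    rw [← LieSubalgebra.mem_toSubmodule, heq]
    exact (hmem_orth _ _).mpr hx
end

section
/- Let (g, ω) be a symplectic Lie algebra over a field k of characteristic 0. Then any two irreducible symplectic bases of (g, ω) are isomorphic as symplectic Lie algebras. In other words: if (b, ω_b) and (b', ω_{b'}) are both symplectic Lie algebras with no nonzero isotropic ideal, and each is obtained from (g, ω) by a finite sequence of subsequent symplectic reductions, then there is a Lie algebra isomorphism φ : b → b' with ω_{b'}(φu, φv) = ω_b(u, v) for all u, v ∈ b. -/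
universe u

/-- A bundled symplectic Lie algebra over a field `k`: a finite-dimensional Lie algebra
together with an alternating, non-degenerate, closed bilinear form. -/
structure SympLieAlg (k : Type u) [Field k] : Type (u + 1) where
  carrier : Type u
  [lieRing : LieRing carrier]
  [lieAlg : LieAlgebra k carrier]
  [finite : Module.Finite k carrier]
  form : carrier →ₗ[k] carrier →ₗ[k] k
  alt : ∀ v, form v v = 0
  nondeg : ∀ v, (∀ w, form v w = 0) → v = 0
  closed : ∀ u v w, form ⁅u, v⁆ w + form ⁅w, u⁆ v + form ⁅v, w⁆ u = 0

attribute [instance] SympLieAlg.lieRing SympLieAlg.lieAlg SympLieAlg.finite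

variable {k : Type u} [Field k]

/-- An isotropic ideal of a symplectic Lie algebra. -/
def SympLieAlg.IsIsotropicIdeal (A : SympLieAlg k) (j : LieIdeal k A.carrier) : Prop :=
  ∀ x ∈ j, ∀ y ∈ j, A.form x y = 0

/-- The orthogonal `j^⊥` of an ideal, as a submodule. -/
def SympLieAlg.perp (A : SympLieAlg k) (j : LieIdeal k A.carrier) :
    Submodule k A.carrier where
  carrier := {v | ∀ a ∈ j, A.form v a = 0}
  add_mem' := by
    intro x y hx hy a ha
    simp [map_add, hx a ha, hy a ha]
  zero_mem' := by
    intro a _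
    simp
  smul_mem' := by
    intro c x hx a ha
    simp [hx a ha]

/-- `B` is a symplectic reduction of `A` with respect to some isotropic ideal `j` of `A`:
there is a surjective linear map `f : j^⊥ → B` with kernel `j`, compatible with the Lie
brackets and with the symplectic forms (so that `B` is identified with `j^⊥/j` with its
induced Lie algebra structure and symplectic form). -/
def IsReduction (A B : SympLieAlg k) : Prop :=
  ∃ j : LieIdeal k A.carrier, A.IsIsotropicIdeal j ∧
    ∃ f : A.perp j →ₗ[k] B.carrier,
      Function.Surjective f ∧
      (∀ x : A.perp j, f x = 0 ↔ (x : A.carrier) ∈ j) ∧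
      (∀ (x y : A.carrier) (hx : x ∈ A.perp j) (hy : y ∈ A.perp j)
          (hxy : ⁅x, y⁆ ∈ A.perp j),
        f ⟨⁅x, y⁆, hxy⟩ = ⁅f ⟨x, hx⟩, f ⟨y, hy⟩⁆) ∧
      (∀ x y : A.perp j, B.form (f x) (f y) = A.form x y)

/-- A symplectic Lie algebra is irreducible if it has no nonzero isotropic ideal. -/
def SympLieAlg.IsIrreducible (A : SympLieAlg k) : Prop :=
  ∀ j : LieIdeal k A.carrier, A.IsIsotropicIdeal j → j = ⊥

/-- `B` is an irreducible symplectic base of `A`: it is obtained from `A` by a finite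
sequence of subsequent symplectic reductions and has no nonzero isotropic ideal. -/
def IsIrreducibleBase (A B : SympLieAlg k) : Prop :=
  (∃ (n : ℕ) (seq : Fin (n + 1) → SympLieAlg k),
      seq 0 = A ∧ seq (Fin.last n) = B ∧
      ∀ i : Fin n, IsReduction (seq i.castSucc) (seq i.succ)) ∧
  B.IsIrreducible

/-- Two symplectic Lie algebras are isomorphic if there is a Lie algebra isomorphism
intertwining the symplectic forms. -/
def SympIso (A B : SympLieAlg k) : Prop :=
  ∃ e : A.carrier ≃ₗ⁅k⁆ B.carrier, ∀ x y, B.form (e x) (e y) = A.form x y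

namespace SympLieAlg

theorem form_swap (A : SympLieAlg k) (u v : A.carrier) : A.form u v = -A.form v u :=
  (LinearMap.IsAlt.neg (show LinearMap.IsAlt A.form from A.alt) v u).symm

theorem form_surjective (A : SympLieAlg k) :
    Function.Surjective (A.form : A.carrier → Module.Dual k A.carrier) := by
  refine (LinearMap.injective_iff_surjective_of_finrank_eq_finrank
    Subspace.dual_finrank_eq.symm).1 ?_
  refine (injective_iff_map_eq_zero A.form).2 fun v hv => A.nondeg v fun w => ?_
  rw [hv, LinearMap.zero_apply]

theorem lie_mem_perp (A : SympLieAlg k) (j : LieIdeal k A.carrier) {x y : A.carrier}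
    (hx : x ∈ A.perp j) (hy : y ∈ A.perp j) : ⁅x, y⁆ ∈ A.perp j := by
  intro a ha
  have h := A.closed x y a
  rw [A.form_swap ⁅a, x⁆, A.form_swap ⁅y, a⁆, hy _ (lie_mem_left k _ j _ _ ha),
    hx _ (lie_mem_right k _ j _ _ ha)] at h
  simpa using h

/-- A Lagrangian correspondence from `A` to `C`: a subspace of the product that is closed under
brackets, Lagrangian for the difference of the two forms, and surjects onto `C`. It exhibits `C`
as the quotient of a coisotropic subalgebra of `A` by its orthogonal. -/
structure IsCorrespondence (A C : SympLieAlg k)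
    (R : Submodule k (A.carrier × C.carrier)) : Prop where
  lie_mem : ∀ {a c a' c'}, (a, c) ∈ R → (a', c') ∈ R → (⁅a, a'⁆, ⁅c, c'⁆) ∈ R
  form_eq : ∀ {a c a' c'}, (a, c) ∈ R → (a', c') ∈ R → A.form a a' = C.form c c'
  mem_of_form_eq : ∀ {a c}, (∀ a' c', (a', c') ∈ R → A.form a a' = C.form c c') → (a, c) ∈ R
  surjective : ∀ c, ∃ a, (a, c) ∈ R

theorem isCorrespondence_diagonal (A : SympLieAlg k) :
    IsCorrespondence A A (LinearMap.id : A.carrier →ₗ[k] A.carrier).graph where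
  lie_mem := by
    intro a c a' c' h h'
    simp only [LinearMap.mem_graph_iff, LinearMap.id_apply] at *
    rw [h, h']
  form_eq := by
    intro a c a' c' h h'
    simp only [LinearMap.mem_graph_iff, LinearMap.id_apply] at *
    rw [h, h']
  mem_of_form_eq := by
    intro a c h
    rw [LinearMap.mem_graph_iff, LinearMap.id_apply, ← sub_eq_zero]
    refine A.nondeg _ fun w => ?_
    rw [map_sub, LinearMap.sub_apply, h w w (by simp), sub_self]
  surjective c := ⟨c, by simp⟩

namespace IsCorrespondence

variable {A C : SympLieAlg k} {R : Submodule k (A.carrier × C.carrier)}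

theorem snd_eq_zero (hR : IsCorrespondence A C R) {c : C.carrier} (h : (0, c) ∈ R) : c = 0 := by
  refine C.nondeg c fun w => ?_
  obtain ⟨a, ha⟩ := hR.surjective w
  rw [← hR.form_eq h ha, map_zero, LinearMap.zero_apply]

/-- The elements of `C` corresponding to some element of an ideal of `A`. -/
def imageIdeal (hR : IsCorrespondence A C R) (i : LieIdeal k A.carrier) :
    LieIdeal k C.carrier where
  carrier := {c | ∃ a ∈ i, (a, c) ∈ R}
  add_mem' := by
    rintro c c' ⟨a, ha, h⟩ ⟨a', ha', h'⟩
    exact ⟨a + a', add_mem ha ha', R.add_mem h h'⟩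
  zero_mem' := ⟨0, zero_mem i, R.zero_mem⟩
  smul_mem' := by
    rintro r c ⟨a, ha, h⟩
    exact ⟨r • a, i.smul_mem r ha, R.smul_mem r h⟩
  lie_mem := by
    rintro c' c ⟨a, ha, h⟩
    obtain ⟨a', h'⟩ := hR.surjective c'
    exact ⟨⁅a', a⁆, lie_mem_right k _ i _ _ ha, hR.lie_mem h' h⟩

theorem eq_zero_of_mem_isotropicIdeal (hR : IsCorrespondence A C R) (hC : C.IsIrreducible)
    {i : LieIdeal k A.carrier} (hi : A.IsIsotropicIdeal i) {a : A.carrier} {c : C.carrier}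
    (ha : a ∈ i) (h : (a, c) ∈ R) : c = 0 := by
  have hbot : hR.imageIdeal i = ⊥ := by
    refine hC _ ?_
    rintro x ⟨a, ha, hx⟩ y ⟨a', ha', hy⟩
    rw [← hR.form_eq hx hy, hi a ha a' ha']
  have hc : c ∈ hR.imageIdeal i := ⟨a, ha, h⟩
  rwa [hbot, LieSubmodule.mem_bot] at hc

/-- Every element of an irreducible `C` corresponds to an element orthogonal to a given
isotropic ideal of `A`. -/
theorem exists_mem_perp (hR : IsCorrespondence A C R) (hC : C.IsIrreducible)
    {i : LieIdeal k A.carrier} (hi : A.IsIsotropicIdeal i) (c : C.carrier) :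
    ∃ a ∈ A.perp i, (a, c) ∈ R := by
  obtain ⟨a, ha⟩ := hR.surjective c
  let S : Submodule k A.carrier := R.map (LinearMap.fst k _ _)
  have hφ : A.form a ∈ (i.toSubmodule ⊓ S).dualAnnihilator := by
    rw [Submodule.mem_dualAnnihilator]
    rintro y ⟨hyi, ⟨⟨y', d⟩, hd, rfl⟩⟩
    obtain rfl := hR.eq_zero_of_mem_isotropicIdeal hC hi hyi hd
    simpa using hR.form_eq ha hd
  rw [Subspace.dualAnnihilator_inf_eq, Submodule.mem_sup] at hφ
  obtain ⟨α, hα, β, hβ, hαβ⟩ := hφ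
  obtain ⟨n, rfl⟩ := A.form_surjective β
  rw [Submodule.mem_dualAnnihilator] at hα hβ
  have hn : (n, (0 : C.carrier)) ∈ R := by
    refine hR.mem_of_form_eq fun a' c' h => ?_
    rw [hβ a' ⟨_, h, rfl⟩, map_zero, LinearMap.zero_apply]
  refine ⟨a - n, fun y hy => ?_, by simpa using R.sub_mem ha hn⟩
  rw [map_sub, ← hαβ, add_sub_cancel_right]
  exact hα y hy

theorem exists_mem_add_mem (hR : IsCorrespondence A C R) {i : LieIdeal k A.carrier}
    {x : A.carrier} {c : C.carrier}
    (h : ∀ a' c', a' ∈ A.perp i → (a', c') ∈ R → A.form x a' = C.form c c') :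
    ∃ y ∈ i, (x + y, c) ∈ R := by
  let F : A.carrier →ₗ[k] Module.Dual k R :=
    (LinearMap.fst k A.carrier C.carrier ∘ₗ R.subtype).dualMap ∘ₗ A.form
  let G : C.carrier →ₗ[k] Module.Dual k R :=
    (LinearMap.snd k A.carrier C.carrier ∘ₗ R.subtype).dualMap ∘ₗ C.form
  have hmem : G c - F x ∈ i.toSubmodule.map F := by
    rw [← Subspace.dualCoannihilator_dualAnnihilator_eq (W := i.toSubmodule.map F),
      Submodule.mem_dualAnnihilator]
    rintro ⟨⟨a', c'⟩, hr⟩ hann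
    rw [Submodule.mem_dualCoannihilator] at hann
    have ha' : a' ∈ A.perp i := by
      intro y hy
      rw [A.form_swap, neg_eq_zero]
      exact hann _ ⟨y, hy, rfl⟩
    change C.form c c' - A.form x a' = 0
    rw [h a' c' ha' hr, sub_self]
  obtain ⟨y, hy, hF⟩ := hmem
  refine ⟨y, hy, hR.mem_of_form_eq fun a' c' hr => ?_⟩
  have := LinearMap.congr_fun hF ⟨(a', c'), hr⟩
  change A.form y a' = C.form c c' - A.form x a' at this
  rw [map_add, LinearMap.add_apply, this, add_sub_cancel]

theorem fst_injective (hR : IsCorrespondence A C R) :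
    Function.Injective (LinearMap.fst k A.carrier C.carrier ∘ₗ R.subtype) := by
  refine (injective_iff_map_eq_zero _).2 ?_
  rintro ⟨⟨a, c⟩, h⟩ ha
  obtain rfl : a = 0 := ha
  obtain rfl := hR.snd_eq_zero h
  rfl

theorem snd_surjective (hR : IsCorrespondence A C R) :
    Function.Surjective (LinearMap.snd k A.carrier C.carrier ∘ₗ R.subtype) := fun c => by
  obtain ⟨a, ha⟩ := hR.surjective c
  exact ⟨⟨_, ha⟩, rfl⟩

theorem finrank_le (hR : IsCorrespondence A C R) :
    Module.finrank k C.carrier ≤ Module.finrank k A.carrier :=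
  (LinearMap.finrank_le_finrank_of_surjective hR.snd_surjective).trans
    (LinearMap.finrank_le_finrank_of_injective hR.fst_injective)

theorem sympIso (hR : IsCorrespondence A C R)
    (hdim : Module.finrank k A.carrier = Module.finrank k C.carrier) : SympIso A C := by
  have h₁ := LinearMap.finrank_le_finrank_of_surjective hR.snd_surjective
  have h₂ := LinearMap.finrank_le_finrank_of_injective hR.fst_injective
  let p : R →ₗ[k] A.carrier := LinearMap.fst k A.carrier C.carrier ∘ₗ R.subtype
  let q : R →ₗ[k] C.carrier := LinearMap.snd k A.carrier C.carrier ∘ₗ R.subtype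
  let e₁ : R ≃ₗ[k] A.carrier := LinearMap.linearEquivOfInjective p hR.fst_injective (by omega)
  let e₂ : R ≃ₗ[k] C.carrier := LinearEquiv.ofBijective q
    ⟨(LinearMap.injective_iff_surjective_of_finrank_eq_finrank (by omega)).2 hR.snd_surjective,
      hR.snd_surjective⟩
  let e : A.carrier ≃ₗ[k] C.carrier := e₁.symm.trans e₂
  have he (a : A.carrier) : (a, e a) ∈ R := by
    have h : (p (e₁.symm a), q (e₁.symm a)) ∈ R := (e₁.symm a).2
    rwa [show p (e₁.symm a) = a from e₁.apply_symm_apply a] at h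
  refine ⟨{ e with map_lie' := ?_ }, fun x y => (hR.form_eq (he x) (he y)).symm⟩
  intro x y
  have h := R.sub_mem (he ⁅x, y⁆) (hR.lie_mem (he x) (he y))
  rw [Prod.mk_sub_mk, sub_self] at h
  exact sub_eq_zero.1 (hR.snd_eq_zero h)

end IsCorrespondence

end SympLieAlg

open SympLieAlg

namespace IsReduction

variable {A B C : SympLieAlg k}

theorem exists_correspondence (hAB : IsReduction A B)
    (hBC : ∃ R, IsCorrespondence B C R) : ∃ R, IsCorrespondence A C R := by
  obtain ⟨j, hj, f, hf, hker, hlie, hform⟩ := hAB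
  obtain ⟨R, hR⟩ := hBC
  let T : Submodule k (A.carrier × C.carrier) :=
    (R.comap (f.prodMap LinearMap.id)).map ((A.perp j).subtype.prodMap LinearMap.id)
  have hT {a : A.carrier} {c : C.carrier} :
      (a, c) ∈ T ↔ ∃ h : a ∈ A.perp j, (f ⟨a, h⟩, c) ∈ R := by
    constructor
    · rintro ⟨⟨⟨x, hx⟩, d⟩, h, heq⟩
      obtain ⟨rfl, rfl⟩ := Prod.mk.inj heq
      exact ⟨hx, h⟩
    · rintro ⟨h, hr⟩
      exact ⟨(⟨a, h⟩, c), hr, rfl⟩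
  refine ⟨T, ?_, ?_, ?_, ?_⟩
  · intro a c a' c' h h'
    obtain ⟨ha, h⟩ := hT.1 h
    obtain ⟨ha', h'⟩ := hT.1 h'
    refine hT.2 ⟨A.lie_mem_perp j ha ha', ?_⟩
    rw [hlie a a' ha ha']
    exact hR.lie_mem h h'
  · intro a c a' c' h h'
    obtain ⟨ha, h⟩ := hT.1 h
    obtain ⟨ha', h'⟩ := hT.1 h'
    rw [← hR.form_eq h h', hform]
  · intro a c h
    have ha : a ∈ A.perp j := by
      intro y hy
      have hyp : y ∈ A.perp j := hj y hy
      rw [h y 0 (hT.2 ⟨hyp, ?_⟩), map_zero]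
      rw [(hker ⟨y, hyp⟩).2 hy]
      exact R.zero_mem
    refine hT.2 ⟨ha, hR.mem_of_form_eq fun b' c' hr => ?_⟩
    obtain ⟨x, rfl⟩ := hf b'
    rw [hform]
    exact h x c' (hT.2 ⟨x.2, hr⟩)
  · intro c
    obtain ⟨b, hb⟩ := hR.surjective c
    obtain ⟨x, rfl⟩ := hf b
    exact ⟨x, hT.2 ⟨x.2, hb⟩⟩

theorem exists_correspondence_of_isIrreducible (hAB : IsReduction A B) (hC : C.IsIrreducible)
    (hAC : ∃ R, IsCorrespondence A C R) : ∃ R, IsCorrespondence B C R := by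
  obtain ⟨i, hi, f, hf, hker, hlie, hform⟩ := hAB
  obtain ⟨R, hR⟩ := hAC
  let T : Submodule k (B.carrier × C.carrier) :=
    (R.comap ((A.perp i).subtype.prodMap LinearMap.id)).map (f.prodMap LinearMap.id)
  have hT {b : B.carrier} {c : C.carrier} :
      (b, c) ∈ T ↔ ∃ x : A.perp i, f x = b ∧ ((x : A.carrier), c) ∈ R := by
    constructor
    · rintro ⟨⟨x, d⟩, h, heq⟩
      obtain ⟨rfl, rfl⟩ := Prod.mk.inj heq
      exact ⟨x, rfl, h⟩
    · rintro ⟨x, rfl, hr⟩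
      exact ⟨(x, c), hr, rfl⟩
  refine ⟨T, ?_, ?_, ?_, ?_⟩
  · intro b c b' c' h h'
    obtain ⟨x, rfl, hr⟩ := hT.1 h
    obtain ⟨x', rfl, hr'⟩ := hT.1 h'
    exact hT.2 ⟨⟨_, A.lie_mem_perp i x.2 x'.2⟩, hlie _ _ x.2 x'.2 _, hR.lie_mem hr hr'⟩
  · intro b c b' c' h h'
    obtain ⟨x, rfl, hr⟩ := hT.1 h
    obtain ⟨x', rfl, hr'⟩ := hT.1 h'
    rw [hform, hR.form_eq hr hr']
  · intro b c h
    obtain ⟨x, rfl⟩ := hf b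
    obtain ⟨y, hy, hr⟩ := hR.exists_mem_add_mem (i := i) (x := x) (c := c) fun a' c' ha' hr => by
      rw [← h (f ⟨a', ha'⟩) c' (hT.2 ⟨_, rfl, hr⟩), hform]
    have hyp : y ∈ A.perp i := hi y hy
    refine hT.2 ⟨x + ⟨y, hyp⟩, ?_, hr⟩
    rw [map_add, (hker ⟨y, hyp⟩).2 hy, add_zero]
  · intro c
    obtain ⟨a, ha, hr⟩ := hR.exists_mem_perp hC hi c
    exact ⟨f ⟨a, ha⟩, hT.2 ⟨_, rfl, hr⟩⟩

end IsReduction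

namespace IsIrreducibleBase

variable {A B B' : SympLieAlg k}

theorem exists_correspondence (hB : IsIrreducibleBase A B) : ∃ R, IsCorrespondence A B R := by
  obtain ⟨⟨n, seq, rfl, rfl, hseq⟩, -⟩ := hB
  exact Fin.reverseInduction (motive := fun m => ∃ R, IsCorrespondence (seq m) (seq (Fin.last n)) R)
    ⟨_, isCorrespondence_diagonal _⟩ (fun m hm => (hseq m).exists_correspondence hm) 0

theorem exists_correspondence_base (hB : IsIrreducibleBase A B) (hB' : IsIrreducibleBase A B') :
    ∃ R, IsCorrespondence B B' R := by
  have h := hB'.exists_correspondence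
  obtain ⟨⟨n, seq, rfl, rfl, hseq⟩, -⟩ := hB
  exact Fin.induction (motive := fun m => ∃ R, IsCorrespondence (seq m) B' R) h
    (fun m hm => (hseq m).exists_correspondence_of_isIrreducible hB'.2 hm) (Fin.last n)

end IsIrreducibleBase

/-- Uniqueness of the base: any two irreducible symplectic bases of a
symplectic Lie algebra are isomorphic as symplectic Lie algebras. -/
theorem stmt_3 [CharZero k] (A B B' : SympLieAlg k)
    (hB : IsIrreducibleBase A B) (hB' : IsIrreducibleBase A B') :
    SympIso B B' := by
  obtain ⟨R, hR⟩ := hB.exists_correspondence_base hB'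
  obtain ⟨R', hR'⟩ := hB'.exists_correspondence_base hB
  exact hR.sympIso (le_antisymm hR'.finrank_le hR.finrank_le)
end

section
/- Every four-dimensional symplectic Lie algebra (g, ω) over the real numbers has a nonzero isotropic ideal; equivalently, there does not exist a four-dimensional real symplectic Lie algebra of symplectic rank zero. -/
open Module

section SymplecticLieAlgebra

/-- Two non-commuting traceless two by two matrices, whose commutator lies in their span, have a
common eigenvector with coordinates `s` and `t`. -/
theorem exists_common_eigenvector_of_traceless {k : Type*} [Field k] [CharZero k]
    {p q r p' q' r' α β : k}
    (h₁ : q * r' - q' * r = α * p + β * p')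
    (h₂ : 2 * (p * q' - p' * q) = α * q + β * q')
    (h₃ : 2 * (p' * r - p * r') = α * r + β * r')
    (hne : ¬ (q * r' - q' * r = 0 ∧ p * q' - p' * q = 0 ∧ p' * r - p * r' = 0)) :
    ∃ s t c d : k, (s ≠ 0 ∨ t ≠ 0) ∧ p * s + q * t = c * s ∧ r * s - p * t = c * t ∧
      p' * s + q' * t = d * s ∧ r' * s - p' * t = d * t := by
  obtain ⟨z₁, hz₁⟩ : ∃ z, z = q * r' - q' * r := ⟨_, rfl⟩
  obtain ⟨z₂, hz₂⟩ : ∃ z, z = p * q' - p' * q := ⟨_, rfl⟩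
  obtain ⟨z₃, hz₃⟩ : ∃ z, z = p' * r - p * r' := ⟨_, rfl⟩
  have hdet : z₁ * z₁ + 4 * (z₂ * z₃) = 0 := by grind
  have htr : p * z₁ + q * z₃ + r * z₂ = 0 := by grind
  have htr' : p' * z₁ + q' * z₃ + r' * z₂ = 0 := by grind
  by_cases h : z₃ = 0
  · have h1 : z₁ = 0 := by simpa [h] using hdet
    have h2 : z₂ ≠ 0 := fun h2 ↦ hne ⟨by grind, by grind, by grind⟩
    have hr : r = 0 := by simpa [h, h1, h2] using htr
    have hr' : r' = 0 := by simpa [h, h1, h2] using htr'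
    exact ⟨1, 0, p, p', by simp, by simp, by simp [hr], by simp, by simp [hr']⟩
  · refine ⟨z₁, 2 * z₃, (r * z₁ - p * (2 * z₃)) / (2 * z₃),
      (r' * z₁ - p' * (2 * z₃)) / (2 * z₃), Or.inr (by simpa using h), ?_, ?_, ?_, ?_⟩
    all_goals field_simp
    all_goals grind

variable {k g : Type*} [Field k] [LieRing g] [LieAlgebra k g]

/-- A common eigenvector of the adjoint action yields a nonzero isotropic ideal. -/
theorem exists_isotropic_ideal_of_eigenvector {ω : LinearMap.BilinForm k g} (halt : ω.IsAlt)
    {v : g} (hv : v ≠ 0) (h : ∀ m : g, ∃ c : k, ⁅m, v⁆ = c • v) :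
    ∃ j : LieIdeal k g, j ≠ ⊥ ∧ ∀ x ∈ j, ∀ y ∈ j, ω x y = 0 := by
  let j : LieIdeal k g :=
    { Submodule.span k {v} with
      lie_mem := by
        intro m w hw
        obtain ⟨a, rfl⟩ := Submodule.mem_span_singleton.1 hw
        obtain ⟨c, hc⟩ := h m
        exact Submodule.mem_span_singleton.2 ⟨a * c, by rw [lie_smul, hc, smul_smul]⟩ }
  have hj : ∀ x ∈ j, ∃ a : k, a • v = x := fun x hx ↦ Submodule.mem_span_singleton.1 hx
  refine ⟨j, fun hbot ↦ hv ?_, fun x hx y hy ↦ ?_⟩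
  · have : v ∈ j := Submodule.mem_span_singleton_self v
    rwa [hbot, LieSubmodule.mem_bot] at this
  · obtain ⟨a, rfl⟩ := hj x hx
    obtain ⟨b, rfl⟩ := hj y hy
    simp [halt v]

/-- A closed form is invariant under the adjoint action on an abelian ideal. -/
theorem apply_lie_eq_neg_of_abelian {ω : LinearMap.BilinForm k g} (halt : ω.IsAlt)
    (hclosed : ∀ u v w : g, ω ⁅u, v⁆ w + ω ⁅w, u⁆ v + ω ⁅v, w⁆ u = 0)
    {u v : g} (huv : ⁅u, v⁆ = 0) (w : g) : ω ⁅w, u⁆ v = - ω u ⁅w, v⁆ := by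
  have h := hclosed u v w
  rw [huv, map_zero, LinearMap.zero_apply, zero_add] at h
  rw [halt.neg_eq, ← lie_skew w v, map_neg, LinearMap.neg_apply]
  linear_combination h

/-- The orthogonal of an ideal with respect to a closed form is closed under the bracket. -/
theorem lie_mem_orthogonal {ω : LinearMap.BilinForm k g} (halt : ω.IsAlt)
    (hclosed : ∀ u v w : g, ω ⁅u, v⁆ w + ω ⁅w, u⁆ v + ω ⁅v, w⁆ u = 0)
    (I : LieIdeal k g) {x y : g} (hx : x ∈ ω.orthogonal I.toSubmodule)
    (hy : y ∈ ω.orthogonal I.toSubmodule) : ⁅x, y⁆ ∈ ω.orthogonal I.toSubmodule := by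
  rw [LinearMap.BilinForm.mem_orthogonal_iff] at *
  intro w hw
  have h := hclosed x y w
  have h1 : ω ⁅w, x⁆ y = 0 := hy _ (lie_mem_left k g I w x hw)
  have h2 : ω ⁅y, w⁆ x = 0 := hx _ (lie_mem_right k g I y w hw)
  rw [h1, h2, add_zero, add_zero] at h
  change ω w ⁅x, y⁆ = 0
  rw [← halt.neg_eq, h, neg_zero]

/-- The part of an abelian ideal orthogonal to the ideal itself, as an ideal. -/
def abelianIdealRadical {ω : LinearMap.BilinForm k g} (halt : ω.IsAlt)
    (hclosed : ∀ u v w : g, ω ⁅u, v⁆ w + ω ⁅w, u⁆ v + ω ⁅v, w⁆ u = 0)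
    (I : LieIdeal k g) (hI : ∀ x ∈ I, ∀ y ∈ I, ⁅x, y⁆ = 0) : LieIdeal k g :=
  { I.toSubmodule ⊓ ω.orthogonal I.toSubmodule with
    lie_mem := by
      intro m u hu
      refine ⟨lie_mem_right k g I m u hu.1, ?_⟩
      rw [SetLike.mem_coe, LinearMap.BilinForm.mem_orthogonal_iff]
      intro w hw
      change ω w ⁅m, u⁆ = 0
      rw [← neg_eq_zero, ← apply_lie_eq_neg_of_abelian halt hclosed (hI w hw u hu.1)]
      exact hu.2 _ (lie_mem_right k g I m w hw) }

/-- A Lie algebra with nondegenerate Killing form carries no symplectic form. -/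
theorem not_isKilling_of_symplectic [FiniteDimensional k g] [Nontrivial g]
    {ω : LinearMap.BilinForm k g} (halt : ω.IsAlt)
    (hnondeg : ∀ u : g, (∀ v : g, ω u v = 0) → u = 0)
    (hclosed : ∀ u v w : g, ω ⁅u, v⁆ w + ω ⁅w, u⁆ v + ω ⁅v, w⁆ u = 0) :
    ¬ LieAlgebra.IsKilling k g := by
  intro hK
  have hκ := LieAlgebra.IsKilling.killingForm_nondegenerate k g
  let D := LinearMap.BilinForm.symmCompOfNondegenerate ω (killingForm k g) hκ
  have hD : ∀ u v, killingForm k g (D u) v = ω u v := fun u v ↦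
    LinearMap.BilinForm.symmCompOfNondegenerate_left_apply ω hκ v u
  let δ : LieDerivation k g g :=
    { D with
      leibniz' := by
        intro a b
        change D ⁅a, b⁆ = ⁅a, D b⁆ - ⁅b, D a⁆
        rw [← sub_eq_zero]
        refine hκ.1 _ fun w ↦ ?_
        have h := hclosed a b w
        have h1 : killingForm k g ⁅a, D b⁆ w = - ω b ⁅a, w⁆ := by
          rw [← hD]; exact LieModule.traceForm_apply_lie_apply' k g g a (D b) w
        have h2 : killingForm k g ⁅b, D a⁆ w = - ω a ⁅b, w⁆ := by
          rw [← hD]; exact LieModule.traceForm_apply_lie_apply' k g g b (D a) w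
        simp only [map_sub, LinearMap.sub_apply, h1, h2, hD]
        rw [halt.neg_eq, halt.neg_eq, ← lie_skew a w, map_neg, LinearMap.neg_apply]
        linear_combination h }
  obtain ⟨x, hx⟩ := LieDerivation.IsKilling.exists_eq_ad δ
  have hDx : ∀ u, D u = ⁅x, u⁆ := fun u ↦ by
    change δ u = _
    rw [← hx, LieDerivation.ad_apply_apply]
  have hx0 : x = 0 := by
    refine hnondeg x fun v ↦ ?_
    rw [← hD, hDx, lie_self, map_zero, LinearMap.zero_apply]
  obtain ⟨u, hu⟩ := exists_ne (0 : g)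
  refine hu (hnondeg u fun v ↦ ?_)
  rw [← hD, hDx, hx0, zero_lie, map_zero, LinearMap.zero_apply]

/-- A subspace of dimension at most one is isotropic. -/
theorem isotropic_of_finrank_le_one [FiniteDimensional k g] {ω : LinearMap.BilinForm k g}
    (halt : ω.IsAlt) {W : Submodule k g} (hW : finrank k W ≤ 1) :
    ∀ x ∈ W, ∀ y ∈ W, ω x y = 0 := by
  intro x hx y hy
  obtain ⟨v, hv⟩ := finrank_le_one_iff.1 hW
  obtain ⟨a, ha⟩ := hv ⟨x, hx⟩
  obtain ⟨b, hb⟩ := hv ⟨y, hy⟩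
  have hxv : x = a • (v : g) := congrArg Subtype.val ha.symm
  have hyv : y = b • (v : g) := congrArg Subtype.val hb.symm
  simp [hxv, hyv, halt (v : g)]

/-- The elements of the orthogonal of an ideal that commute with the ideal, as an ideal. -/
def orthogonalCentralizer {ω : LinearMap.BilinForm k g} (halt : ω.IsAlt)
    (hclosed : ∀ u v w : g, ω ⁅u, v⁆ w + ω ⁅w, u⁆ v + ω ⁅v, w⁆ u = 0)
    (I : LieIdeal k g) : LieIdeal k g where
  carrier := {v | v ∈ ω.orthogonal I.toSubmodule ∧ ∀ w ∈ I, ⁅v, w⁆ = 0}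
  zero_mem' := ⟨zero_mem _, by simp⟩
  add_mem' hu hv := ⟨add_mem hu.1 hv.1, fun w hw ↦ by
    rw [add_lie, hu.2 w hw, hv.2 w hw, add_zero]⟩
  smul_mem' c v hv := ⟨Submodule.smul_mem _ c hv.1, fun w hw ↦ by
    rw [smul_lie, hv.2 w hw, smul_zero]⟩
  lie_mem := by
    rintro m v ⟨hv, hvI⟩
    refine ⟨?_, fun w hw ↦ ?_⟩
    · rw [LinearMap.BilinForm.mem_orthogonal_iff] at *
      intro w hw
      have h := hclosed m v w
      have h1 : ω ⁅w, m⁆ v = 0 := hv _ (lie_mem_left k g I w m hw)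
      rw [h1, hvI w hw, map_zero, LinearMap.zero_apply, add_zero, add_zero] at h
      change ω w ⁅m, v⁆ = 0
      rw [← halt.neg_eq, h, neg_zero]
    · rw [lie_lie, hvI w hw, hvI _ (lie_mem_right k g I m w hw), lie_zero, sub_zero]

/-- A two-dimensional subspace has a basis consisting of two vectors. -/
theorem exists_pair_of_finrank_eq_two {V : Type*} [AddCommGroup V] [Module k V]
    [FiniteDimensional k V] {W : Submodule k V} (hW : finrank k W = 2) :
    ∃ e ∈ W, ∃ f ∈ W, (∀ a b : k, a • e + b • f = 0 → a = 0 ∧ b = 0) ∧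
      ∀ w ∈ W, ∃ a b : k, w = a • e + b • f := by
  let b := finBasisOfFinrankEq k W hW
  refine ⟨b 0, (b 0).2, b 1, (b 1).2, fun x y hxy ↦ ?_, fun w hw ↦ ?_⟩
  · have h := Fintype.linearIndependent_iff.1 b.linearIndependent ![x, y]
      (Subtype.ext (by simpa [Fin.sum_univ_two] using hxy))
    exact ⟨h 0, h 1⟩
  · refine ⟨b.repr ⟨w, hw⟩ 0, b.repr ⟨w, hw⟩ 1, ?_⟩
    have := congrArg Subtype.val (b.sum_repr ⟨w, hw⟩)
    rw [Fin.sum_univ_two] at this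
    exact this.symm

/-- The case of a non-degenerate abelian ideal of dimension two in dimension four. -/
theorem exists_isotropic_ideal_of_abelian_plane [CharZero k] [FiniteDimensional k g]
    {ω : LinearMap.BilinForm k g} (halt : ω.IsAlt)
    (hclosed : ∀ u v w : g, ω ⁅u, v⁆ w + ω ⁅w, u⁆ v + ω ⁅v, w⁆ u = 0)
    (I : LieIdeal k g) (hI : ∀ x ∈ I, ∀ y ∈ I, ⁅x, y⁆ = 0)
    (hcompl : IsCompl I.toSubmodule (ω.orthogonal I.toSubmodule))
    (hrank : finrank k I.toSubmodule = 2)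
    (hrank' : finrank k (ω.orthogonal I.toSubmodule) = 2) :
    ∃ j : LieIdeal k g, j ≠ ⊥ ∧ ∀ x ∈ j, ∀ y ∈ j, ω x y = 0 := by
  obtain ⟨e, he, f, hf, hlin, hspan⟩ := exists_pair_of_finrank_eq_two hrank
  have hdecomp : ∀ m : g, ∃ i ∈ I, ∃ h ∈ ω.orthogonal I.toSubmodule, i + h = m := fun m ↦
    Submodule.mem_sup.1 (hcompl.sup_eq_top ▸ Submodule.mem_top : m ∈ _ ⊔ _)
  have hef : ⁅e, f⁆ = 0 := hI e he f hf
  have hω : ω e f ≠ 0 := by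
    intro h0
    have : f ∈ ω.orthogonal I.toSubmodule := by
      rw [LinearMap.BilinForm.mem_orthogonal_iff]
      intro w hw
      obtain ⟨a, b, rfl⟩ := hspan w hw
      change ω (a • e + b • f) f = 0
      simp [h0, halt f]
    have hf0 : f = 0 := Submodule.disjoint_def.1 hcompl.disjoint f hf this
    simpa using (hlin 0 1 (by simp [hf0])).2
  by_cases hK : orthogonalCentralizer halt hclosed I = ⊥
  · obtain ⟨x, hx, y, hy, hlin', hspan'⟩ := exists_pair_of_finrank_eq_two hrank'
    have hfaithful : ∀ v ∈ ω.orthogonal I.toSubmodule, ⁅v, e⁆ = 0 → ⁅v, f⁆ = 0 → v = 0 := by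
      intro v hv hve hvf
      have : v ∈ orthogonalCentralizer halt hclosed I := by
        refine ⟨hv, fun w hw ↦ ?_⟩
        obtain ⟨a, b, rfl⟩ := hspan w hw
        simp [hve, hvf]
      rwa [hK, LieSubmodule.mem_bot] at this
    have hmatrix : ∀ v : g, ∃ p q r : k, ⁅v, e⁆ = p • e + r • f ∧ ⁅v, f⁆ = q • e + (-p) • f := by
      intro v
      obtain ⟨p, r, h1⟩ := hspan _ (lie_mem_right k g I v e he)
      obtain ⟨q, s, h2⟩ := hspan _ (lie_mem_right k g I v f hf)
      have h := apply_lie_eq_neg_of_abelian halt hclosed hef v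
      simp only [h1, h2, map_add, map_smul, LinearMap.add_apply, LinearMap.smul_apply, halt e,
        halt f, smul_eq_mul, mul_zero, add_zero, zero_add] at h
      have hs : s = -p := mul_right_cancel₀ hω (by linear_combination h)
      exact ⟨p, q, r, h1, by rw [h2, hs]⟩
    obtain ⟨p, q, r, hxe, hxf⟩ := hmatrix x
    obtain ⟨p', q', r', hye, hyf⟩ := hmatrix y
    obtain ⟨α, β, hxy⟩ := hspan' _ (lie_mem_orthogonal halt hclosed I hx hy)
    have hje : (q * r' - q' * r - (α * p + β * p')) • e
        + (2 * (p' * r - p * r') - (α * r + β * r')) • f = 0 := by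
      have h := lie_lie x y e
      simp only [hxy, hxe, hye, hxf, hyf, add_lie, smul_lie, lie_add, lie_smul] at h
      linear_combination (norm := module) -h
    have hjf : (2 * (p * q' - p' * q) - (α * q + β * q')) • e
        + (- (q * r' - q' * r) + (α * p + β * p')) • f = 0 := by
      have h := lie_lie x y f
      simp only [hxy, hxe, hye, hxf, hyf, add_lie, smul_lie, lie_add, lie_smul] at h
      linear_combination (norm := module) -h
    have hne : ¬ (q * r' - q' * r = 0 ∧ p * q' - p' * q = 0 ∧ p' * r - p * r' = 0) := by
      rintro ⟨h1, h2, h3⟩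
      have hzero : ∀ a b : k, a * p + b * p' = 0 → a * q + b * q' = 0 → a * r + b * r' = 0 →
          a = 0 ∧ b = 0 := by
        intro a b hp hq hr
        refine hlin' a b (hfaithful _ (add_mem (Submodule.smul_mem _ a hx)
          (Submodule.smul_mem _ b hy)) ?_ ?_)
        · simp only [add_lie, smul_lie, hxe, hye]
          linear_combination (norm := module) hp • e + hr • f
        · simp only [add_lie, smul_lie, hxf, hyf]
          linear_combination (norm := module) hq • e - hp • f
      have hp := hzero p' (-p) (by ring) (by linear_combination -h2) (by linear_combination h3)
      have hq := hzero q' (-q) (by linear_combination h2) (by ring) (by linear_combination -h1)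
      have hr := hzero r' (-r) (by linear_combination -h3) (by linear_combination h1) (by ring)
      simpa using (hzero 1 0 (by linear_combination -hp.2) (by linear_combination -hq.2)
        (by linear_combination -hr.2)).1
    obtain ⟨s, t, c, d, hst, h1, h2, h3, h4⟩ := exists_common_eigenvector_of_traceless
      (sub_eq_zero.1 (hlin _ _ hje).1) (sub_eq_zero.1 (hlin _ _ hjf).1)
      (sub_eq_zero.1 (hlin _ _ hje).2) hne
    refine exists_isotropic_ideal_of_eigenvector halt (v := s • e + t • f) ?_ fun m ↦ ?_
    · intro h
      have := hlin s t h
      tauto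
    · obtain ⟨i, hi, h, hh, rfl⟩ := hdecomp m
      obtain ⟨a, b, rfl⟩ := hspan' h hh
      refine ⟨a * c + b * d, ?_⟩
      simp only [add_lie, lie_add, lie_smul, smul_lie, hI i hi e he, hI i hi f hf, hxe, hye, hxf,
        hyf]
      linear_combination (norm := module) (a * h1) • e + (a * h2) • f + (b * h3) • e + (b * h4) • f
  · rcases (show (orthogonalCentralizer halt hclosed I).toSubmodule ≤ ω.orthogonal I.toSubmodule
      from fun v hv ↦ hv.1).eq_or_lt with heq | hlt
    · have he0 : e ≠ 0 := fun h ↦ by simpa using (hlin 1 0 (by simp [h])).1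
      refine exists_isotropic_ideal_of_eigenvector halt he0 fun m ↦ ⟨0, ?_⟩
      obtain ⟨i, hi, h, hh, rfl⟩ := hdecomp m
      rw [← heq] at hh
      rw [add_lie, hI i hi e he, hh.2 e he, add_zero, zero_smul]
    · have := Submodule.finrank_lt_finrank_of_lt hlt
      exact ⟨_, hK, isotropic_of_finrank_le_one halt (by omega)⟩

/-- A four-dimensional symplectic Lie algebra with a nonzero abelian ideal has a nonzero isotropic
ideal. -/
theorem exists_isotropic_ideal_of_abelian_ideal [CharZero k] [FiniteDimensional k g]
    {ω : LinearMap.BilinForm k g} (halt : ω.IsAlt)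
    (hnondeg : ∀ u : g, (∀ v : g, ω u v = 0) → u = 0)
    (hclosed : ∀ u v w : g, ω ⁅u, v⁆ w + ω ⁅w, u⁆ v + ω ⁅v, w⁆ u = 0)
    (hdim : finrank k g = 4) (I : LieIdeal k g) (hI : ∀ x ∈ I, ∀ y ∈ I, ⁅x, y⁆ = 0)
    (hbot : I ≠ ⊥) :
    ∃ j : LieIdeal k g, j ≠ ⊥ ∧ ∀ x ∈ j, ∀ y ∈ j, ω x y = 0 := by
  by_cases hR : abelianIdealRadical halt hclosed I hI = ⊥
  swap
  · exact ⟨_, hR, fun x hx y hy ↦ hy.2 x hx.1⟩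
  have hdisj : Disjoint I.toSubmodule (ω.orthogonal I.toSubmodule) := by
    rw [Submodule.disjoint_def]
    intro x hx hx'
    have : x ∈ abelianIdealRadical halt hclosed I hI := ⟨hx, hx'⟩
    rwa [hR, LieSubmodule.mem_bot] at this
  have hcompl := (LinearMap.BilinForm.isCompl_orthogonal_iff_disjoint halt.isRefl).2 hdisj
  have hsum := Submodule.finrank_add_eq_of_isCompl hcompl
  rcases Nat.lt_or_ge 1 (finrank k I.toSubmodule) with h1 | h1
  swap
  · exact ⟨I, hbot, isotropic_of_finrank_le_one halt h1⟩
  rcases Nat.lt_or_ge 1 (finrank k (ω.orthogonal I.toSubmodule)) with h2 | h2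
  · exact exists_isotropic_ideal_of_abelian_plane halt hclosed I hI hcompl (by omega) (by omega)
  have hdecomp : ∀ m : g, ∃ i ∈ I, ∃ h ∈ ω.orthogonal I.toSubmodule, i + h = m := fun m ↦
    Submodule.mem_sup.1 (hcompl.sup_eq_top ▸ Submodule.mem_top : m ∈ _ ⊔ _)
  have hzero : ∀ v ∈ ω.orthogonal I.toSubmodule, v = 0 := by
    intro v hv
    refine hnondeg v fun m ↦ ?_
    obtain ⟨i, hi, h, hh, rfl⟩ := hdecomp m
    have hi0 : ω i v = 0 := hv i hi
    rw [map_add, isotropic_of_finrank_le_one halt h2 v hv h hh, ← halt.neg_eq, hi0, neg_zero,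
      add_zero]
  obtain ⟨v, hv, hv0⟩ := Submodule.exists_mem_ne_zero_of_ne_bot
    (fun h ↦ hbot ((LieSubmodule.toSubmodule_eq_bot I).1 h))
  refine exists_isotropic_ideal_of_eigenvector halt hv0 fun m ↦ ⟨0, ?_⟩
  obtain ⟨i, hi, h, hh, rfl⟩ := hdecomp m
  rw [hzero h hh, add_zero, hI i hi v hv, zero_smul]

end SymplecticLieAlgebra

/-- Every four-dimensional real symplectic Lie algebra has a nonzero
isotropic ideal (there is no four-dimensional real symplectic Lie algebra of
symplectic rank zero). -/
theorem stmt_4 {g : Type*} [LieRing g] [LieAlgebra ℝ g] [Module.Finite ℝ g]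
    (ω : g →ₗ[ℝ] g →ₗ[ℝ] ℝ)
    (halt : ∀ u : g, ω u u = 0)
    (hnondeg : ∀ u : g, (∀ v : g, ω u v = 0) → u = 0)
    (hclosed : ∀ u v w : g, ω ⁅u, v⁆ w + ω ⁅w, u⁆ v + ω ⁅v, w⁆ u = 0)
    (hdim : Module.finrank ℝ g = 4) :
    ∃ j : LieIdeal ℝ g, j ≠ ⊥ ∧ ∀ x ∈ j, ∀ y ∈ j, ω x y = 0 := by
  have : Nontrivial g := Module.nontrivial_of_finrank_pos (R := ℝ) (by omega)
  have hrad : ¬ LieAlgebra.HasTrivialRadical ℝ g := fun _ ↦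
    not_isKilling_of_symplectic halt hnondeg hclosed inferInstance
  rw [LieAlgebra.hasTrivialRadical_iff_no_abelian_ideals] at hrad
  push Not at hrad
  obtain ⟨I, hI, hbot⟩ := hrad
  refine exists_isotropic_ideal_of_abelian_ideal halt hnondeg hclosed hdim I
    (fun x hx y hy ↦ ?_) hbot
  exact congrArg Subtype.val (hI.trivial ⟨x, hx⟩ ⟨y, hy⟩)
end

section
/- Let (g, ω) be a symplectic Lie algebra over a field k of characteristic 0 such that g is completely solvable, i.e. there is a flag of Lie ideals 0 = a₀ ⊂ a₁ ⊂ ⋯ ⊂ a_n = g of g with dim a_i = i, where n = dim g. Then (g, ω) has a Lagrangian subalgebra: there is a Lie subalgebra l of g which is isotropic with dim l = ½ dim g. -/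
open LinearMap (BilinForm)

/-- For a non-degenerate reflexive form, the orthogonal of an intersection is contained in the sum
of the orthogonals. -/
theorem orthogonal_inf_le {k V : Type*} [Field k] [AddCommGroup V] [Module k V]
    [FiniteDimensional k V] {B : BilinForm k V} (hB : B.Nondegenerate) (hr : B.IsRefl)
    (U W : Submodule k V) :
    B.orthogonal (U ⊓ W) ≤ B.orthogonal U ⊔ B.orthogonal W := by
  rw [← BilinForm.orthogonal_orthogonal hB hr (B.orthogonal U ⊔ B.orthogonal W)]
  refine BilinForm.orthogonal_le (le_inf ?_ ?_)
  · conv_rhs => rw [← BilinForm.orthogonal_orthogonal hB hr U]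
    exact BilinForm.orthogonal_le le_sup_left
  · conv_rhs => rw [← BilinForm.orthogonal_orthogonal hB hr W]
    exact BilinForm.orthogonal_le le_sup_right

/-- The span of the radicals of the restrictions of `B` to the members of a family of subspaces. -/
def radicalSpan {k V ι : Type*} [Field k] [AddCommGroup V] [Module k V]
    (B : BilinForm k V) (a : ι → Submodule k V) : Submodule k V :=
  ⨆ i, a i ⊓ B.orthogonal (a i)

section radicalSpan

variable {k V : Type*} [Field k] [AddCommGroup V] [Module k V] {B : BilinForm k V}

theorem radicalSpan_isotropic {ι : Type*} [LinearOrder ι] (hr : B.IsRefl)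
    {a : ι → Submodule k V} (ha : Monotone a) {x y : V}
    (hx : x ∈ radicalSpan B a) (hy : y ∈ radicalSpan B a) : B x y = 0 := by
  induction hx using Submodule.iSup_induction' with
  | zero => simp
  | add u v _ _ hu hv => simp [hu, hv]
  | mem i x hx =>
    induction hy using Submodule.iSup_induction' with
    | zero => simp
    | add u v _ _ hu hv => simp [hu, hv]
    | mem j y hy =>
      rcases le_total i j with hij | hji
      · exact hy.2 x (ha hij hx.1)
      · exact hr _ _ (hx.2 y (ha hji hy.1))

/-- Along a complete flag, the span of the radicals contains its own orthogonal. -/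
theorem orthogonal_radicalSpan_le [FiniteDimensional k V] (hB : B.Nondegenerate) (hB' : B.IsAlt)
    {n : ℕ} {a : Fin (n + 1) → Submodule k V} (ha : Monotone a)
    (hdim : ∀ i, Module.finrank k (a i) = (i : ℕ)) (i : Fin (n + 1)) :
    a i ⊓ B.orthogonal (radicalSpan B a) ≤ radicalSpan B a := by
  have hr : B.IsRefl := hB'.isRefl
  induction i using Fin.induction with
  | zero =>
    have h0 : a 0 = ⊥ := Submodule.finrank_eq_zero.mp (by simpa using hdim 0)
    simp [h0]
  | succ i ih =>
    rintro v ⟨hv, hv'⟩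
    have hle : a i.castSucc ≤ a i.succ := ha (Fin.castSucc_lt_succ).le
    have hsub : v ∈ B.orthogonal (a i.castSucc ⊓ B.orthogonal (a i.castSucc)) :=
      BilinForm.orthogonal_le (le_iSup (fun j => a j ⊓ B.orthogonal (a j)) i.castSucc) hv'
    have hsum := orthogonal_inf_le hB hr _ _ hsub
    rw [BilinForm.orthogonal_orthogonal hB hr] at hsum
    obtain ⟨b, hb, c, hc, rfl⟩ := Submodule.mem_sup.mp hsum
    by_cases hba : b ∈ a i.castSucc
    · exact ih ⟨add_mem hba hc, hv'⟩
    have hb' : b ∈ a i.succ := by simpa using sub_mem hv (hle hc)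
    have hspan : a i.castSucc ⊔ k ∙ b = a i.succ := by
      refine Submodule.eq_of_le_of_finrank_le
        (sup_le hle ((Submodule.span_singleton_le_iff_mem _ _).mpr hb')) ?_
      have hlt : a i.castSucc < a i.castSucc ⊔ k ∙ b :=
        lt_of_le_of_ne le_sup_left fun h => hba (h ▸ Submodule.mem_sup_right
          (Submodule.mem_span_singleton_self b))
      have := Submodule.finrank_lt_finrank_of_lt hlt
      rw [hdim] at this ⊢
      simpa using this
    have hbrad : b ∈ radicalSpan B a := by
      refine Submodule.mem_iSup_of_mem i.succ ⟨hb', fun w hw => ?_⟩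
      rw [← hspan] at hw
      obtain ⟨p, hp, q, hq, rfl⟩ := Submodule.mem_sup.mp hw
      obtain ⟨t, rfl⟩ := Submodule.mem_span_singleton.mp hq
      have h1 : B p b = 0 := hb p hp
      have h2 : B b b = 0 := hB' b
      simp [h1, h2]
    have hborth : b ∈ B.orthogonal (radicalSpan B a) :=
      fun w hw => radicalSpan_isotropic hr ha hw hbrad
    exact add_mem hbrad (ih ⟨hc, by simpa using sub_mem hv' hborth⟩)

end radicalSpan

/-- For a closed form and a chain of Lie ideals, the span of the radicals is closed under the
bracket. -/
theorem lie_mem_radicalSpan {k g ι : Type*} [Field k] [LieRing g] [LieAlgebra k g] [LinearOrder ι]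
    {ω : BilinForm k g} (hr : ω.IsRefl)
    (hclosed : ∀ u v w : g, ω ⁅u, v⁆ w + ω ⁅w, u⁆ v + ω ⁅v, w⁆ u = 0)
    {a : ι → LieIdeal k g} (ha : Monotone a) {x y : g}
    (hx : x ∈ radicalSpan ω fun i => (a i).toSubmodule)
    (hy : y ∈ radicalSpan ω fun i => (a i).toSubmodule) :
    ⁅x, y⁆ ∈ radicalSpan ω fun i => (a i).toSubmodule := by
  have key : ∀ i j, i ≤ j → ∀ x ∈ (a i).toSubmodule ⊓ ω.orthogonal (a i).toSubmodule,
      ∀ y ∈ (a j).toSubmodule ⊓ ω.orthogonal (a j).toSubmodule,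
      ⁅x, y⁆ ∈ radicalSpan ω fun i => (a i).toSubmodule := by
    rintro i j hij x ⟨hx, hx'⟩ y ⟨hy, hy'⟩
    refine Submodule.mem_iSup_of_mem i ⟨lie_mem_left k g (a i) x y hx, fun w hw => hr _ _ ?_⟩
    have h1 : ω ⁅w, x⁆ y = 0 := hy' _ (ha hij (lie_mem_right k g (a i) w x hx))
    have h2 : ω ⁅y, w⁆ x = 0 := hx' _ (lie_mem_right k g (a i) y w hw)
    simpa [h1, h2] using hclosed x y w
  induction hx using Submodule.iSup_induction' with
  | zero => simp
  | add u v _ _ hu hv => rw [add_lie]; exact add_mem hu hv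
  | mem i x hx =>
    induction hy using Submodule.iSup_induction' with
    | zero => simp
    | add u v _ _ hu hv => rw [lie_add]; exact add_mem hu hv
    | mem j y hy =>
      rcases le_total i j with hij | hji
      · exact key i j hij x hx y hy
      · rw [← lie_skew]
        exact neg_mem (key j i hji y hy x hx)

/-- A completely solvable symplectic Lie algebra (one admitting a complete
flag of Lie ideals) has a Lagrangian subalgebra. -/
theorem stmt_5 {k : Type*} [Field k] [CharZero k]
    {g : Type*} [LieRing g] [LieAlgebra k g] [Module.Finite k g]
    (ω : g →ₗ[k] g →ₗ[k] k)
    (halt : ∀ u : g, ω u u = 0)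
    (hnondeg : ∀ u : g, (∀ v : g, ω u v = 0) → u = 0)
    (hclosed : ∀ u v w : g, ω ⁅u, v⁆ w + ω ⁅w, u⁆ v + ω ⁅v, w⁆ u = 0)
    (flag : Fin (Module.finrank k g + 1) → LieIdeal k g)
    (hmono : Monotone flag)
    (hflag : ∀ i, Module.finrank k (flag i).toSubmodule = (i : ℕ)) :
    ∃ l : LieSubalgebra k g,
      (∀ x ∈ l, ∀ y ∈ l, ω x y = 0) ∧
      2 * Module.finrank k l.toSubmodule = Module.finrank k g := by
  have hA : BilinForm.IsAlt ω := halt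
  have hr : BilinForm.IsRefl ω := hA.isRefl
  have hB : BilinForm.Nondegenerate ω :=
    ⟨hnondeg, fun u hu => hnondeg u fun v => hr _ _ (hu v)⟩
  set a : Fin (Module.finrank k g + 1) → Submodule k g := fun i => (flag i).toSubmodule
  have ha : Monotone a := fun i j hij => hmono hij
  have htop : a (Fin.last _) = ⊤ :=
    Submodule.eq_top_of_finrank_eq (by simpa using hflag (Fin.last _))
  have hiso : ∀ x ∈ radicalSpan ω a, ∀ y ∈ radicalSpan ω a, ω x y = 0 :=
    fun x hx y hy => radicalSpan_isotropic hr ha hx hy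
  have hlag : BilinForm.orthogonal ω (radicalSpan ω a) = radicalSpan ω a := by
    refine le_antisymm ?_ fun y hy x hx => hiso x hx y hy
    simpa [htop] using orthogonal_radicalSpan_le hB hA ha hflag (Fin.last _)
  refine ⟨{ radicalSpan ω a with
    lie_mem' := fun hx hy => lie_mem_radicalSpan hr hclosed hmono hx hy }, hiso, ?_⟩
  have hfin := BilinForm.finrank_orthogonal hB (radicalSpan ω a)
  have hle := Submodule.finrank_le (radicalSpan ω a)
  rw [hlag] at hfin
  change 2 * Module.finrank k (radicalSpan ω a) = _
  omega
end

section
/- Let (g, ω) be a real symplectic Lie algebra. Suppose that g = h ⊕ a is a vector space direct sum, where h is an abelian Lie subalgebra, a is an abelian Lie ideal, and a decomposes as a = a₁ ⊕ ⋯ ⊕ a_m, where each a_i is a two-dimensional subspace which is non-degenerate with respect to ω, the a_i are pairwise ω-orthogonal, and there exist a linear complex structure J on a (J² = −id) preserving each a_i, and linear functionals λ₁, …, λ_m : h → ℝ such that [H, v] = λ_i(H) J v for all H ∈ h and v ∈ a_i. Assume moreover that each λ_i is nonzero, that λ_i ≠ λ_j and λ_i ≠ −λ_j for all i ≠ j,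 and that λ₁, …, λ_m span the dual space h*. Then (g, ω) is irreducible: it has no nonzero isotropic ideal. -/
/-- A two-dimensional subspace carrying a complex structure `J` is spanned by `x` and `J x`
for any nonzero `x`. -/
theorem exists_eq_smul_add_smul_complexStructure {V : Type*} [AddCommGroup V] [Module ℝ V]
    {B : Submodule ℝ V} (hB : Module.finrank ℝ B = 2) (J : V →ₗ[ℝ] V)
    {x : V} (hx : x ∈ B) (hJx : J x ∈ B) (hJJx : J (J x) = -x) (hx0 : x ≠ 0)
    {y : V} (hy : y ∈ B) : ∃ s t : ℝ, s • x + t • J x = y := by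
  have hli : LinearIndependent ℝ ![x, J x] := by
    refine LinearIndependent.pair_iff.2 fun s t hst => ?_
    have hJst : s • J x - t • x = 0 := by
      simpa [hJJx, sub_eq_add_neg] using congrArg J hst
    have hsq : (s * s + t * t) • x = 0 := by
      have hcomb : (s * s + t * t) • x = s • (s • x + t • J x) - t • (s • J x - t • x) := by module
      rw [hcomb, hst, hJst, smul_zero, smul_zero, sub_zero]
    have hzero : s * s + t * t = 0 := (smul_eq_zero.1 hsq).resolve_right hx0
    exact ⟨by nlinarith, by nlinarith⟩
  have : Module.Finite ℝ B := Module.finite_of_finrank_pos (by omega)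
  have hspan : Submodule.span ℝ (Set.range ![x, J x]) = B := by
    refine Submodule.eq_of_le_of_finrank_eq ?_ ?_
    · rw [Submodule.span_le]
      rintro _ ⟨k, rfl⟩
      fin_cases k <;> simpa
    · rw [finrank_span_eq_card hli, hB, Fintype.card_fin]
  rwa [← hspan, Matrix.range_cons_cons_empty, Submodule.mem_span_pair] at hy

/-- Two linear functionals which differ up to sign have different squares at some vector. -/
theorem Module.Dual.exists_sq_ne_sq {K V : Type*} [Field K] [AddCommGroup V] [Module K V]
    {f g : Module.Dual K V} (hsub : f ≠ g) (hadd : f ≠ -g) : ∃ v, f v ^ 2 ≠ g v ^ 2 := by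
  by_contra! hsq
  obtain ⟨u, hu⟩ := DFunLike.exists_ne hsub
  obtain ⟨v, hv⟩ := DFunLike.exists_ne hadd
  have hu' : f u + g u = 0 :=
    (mul_eq_zero.1 (by linear_combination hsq u : (f u + g u) * (f u - g u) = 0)).resolve_right
      (sub_ne_zero.2 hu)
  have hv0 : f v + g v ≠ 0 := fun h0 => hv (by simpa using eq_neg_of_add_eq_zero_left h0)
  have hv' : f v - g v = 0 :=
    (mul_eq_zero.1 (by linear_combination hsq v : (f v + g v) * (f v - g v) = 0)).resolve_left hv0
  have huv := hsq (u + v)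
  simp only [map_add] at huv
  exact mul_ne_zero hv0 (sub_ne_zero.2 hu)
    (by linear_combination huv - (f u - g u + f v - g v) * hu' - (f v + g v) * hv')


/-- A real symplectic Lie algebra `g = h ⊕ a` with `h` an abelian subalgebra,
`a` an abelian ideal decomposing into pairwise orthogonal non-degenerate two-dimensional
subspaces `a_i`, on which `h` acts by `[H, v] = λ_i(H) • J v` for a complex structure `J`,
with all `λ_i` nonzero, mutually distinct up to sign, and spanning `h*`, is irreducible:
it has no nonzero isotropic ideal. -/
theorem stmt_6 {g : Type*} [LieRing g] [LieAlgebra ℝ g] [Module.Finite ℝ g]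
    (ω : g →ₗ[ℝ] g →ₗ[ℝ] ℝ)
    (halt : ∀ u : g, ω u u = 0)
    (hnondeg : ∀ u : g, (∀ v : g, ω u v = 0) → u = 0)
    (hclosed : ∀ u v w : g, ω ⁅u, v⁆ w + ω ⁅w, u⁆ v + ω ⁅v, w⁆ u = 0)
    (h : LieSubalgebra ℝ g) (a : LieIdeal ℝ g)
    (hcompl : IsCompl h.toSubmodule a.toSubmodule)
    (hhab : ∀ x ∈ h, ∀ y ∈ h, ⁅x, y⁆ = (0 : g))
    (haab : ∀ x ∈ a, ∀ y ∈ a, ⁅x, y⁆ = (0 : g))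
    (m : ℕ) (A : Fin m → Submodule ℝ g)
    (hAa : ∀ i, A i ≤ a.toSubmodule)
    (hsup : (⨆ i, A i) = a.toSubmodule)
    (hdim : ∀ i, Module.finrank ℝ (A i) = 2)
    (hnd : ∀ i, ∀ x ∈ A i, (∀ y ∈ A i, ω x y = 0) → x = 0)
    (horth : ∀ i j, i ≠ j → ∀ x ∈ A i, ∀ y ∈ A j, ω x y = 0)
    (J : g →ₗ[ℝ] g)
    (hJA : ∀ i, ∀ v ∈ A i, J v ∈ A i)
    (hJ2 : ∀ v ∈ a, J (J v) = -v)
    (lam : Fin m → Module.Dual ℝ h)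
    (hbracket : ∀ i, ∀ H : h, ∀ v ∈ A i, ⁅(H : g), v⁆ = lam i H • J v)
    (hlam0 : ∀ i, lam i ≠ 0)
    (hlamij : ∀ i j, i ≠ j → lam i ≠ lam j ∧ lam i ≠ -lam j)
    (hspan : Submodule.span ℝ (Set.range lam) = ⊤) :
    ∀ j : LieIdeal ℝ g, (∀ x ∈ j, ∀ y ∈ j, ω x y = 0) → j = ⊥ := by
  intro j hj
  have hAj : ∀ i, ∀ x ∈ A i, x ∈ j → x = 0 := by
    intro i x hx hxj
    by_contra hx0
    obtain ⟨H, hH⟩ := DFunLike.exists_ne (hlam0 i)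
    have hJxj : J x ∈ j := by
      have hmem : ⁅(H : g), x⁆ ∈ j := lie_mem_right ℝ g j _ _ hxj
      rw [hbracket i H x hx] at hmem
      exact (j.toSubmodule.smul_mem_iff hH).1 hmem
    refine hx0 (hnd i x hx fun y hy => ?_)
    obtain ⟨s, t, rfl⟩ := exists_eq_smul_add_smul_complexStructure (hdim i) J hx (hJA i x hx)
      (hJ2 x (hAa i hx)) hx0 hy
    simp [halt, hj x hxj _ hJxj]
  have hsupport : ∀ S : Finset (Fin m), ∀ w : Fin m → g, (∀ k, w k ∈ A k) →
      ∑ k ∈ S, w k ∈ j → ∀ k ∈ S, w k = 0 := by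
    intro S
    induction S using Finset.induction_on with
    | empty => simp
    | insert p S hp ih =>
      intro w hw hwj
      have hS : ∀ k ∈ S, w k = 0 := by
        intro i hi
        obtain ⟨hsub, hadd⟩ := hlamij p i (ne_of_mem_of_not_mem hi hp).symm
        obtain ⟨K, hK⟩ := Module.Dual.exists_sq_ne_sq hsub hadd
        have hKK : ∀ k, ⁅(K : g), ⁅(K : g), w k⁆⁆ = -(lam k K ^ 2 • w k) := by
          intro k
          rw [hbracket k K _ (hw k), lie_smul, hbracket k K _ (hJA k _ (hw k)),
            hJ2 _ (hAa k (hw k)), smul_smul, smul_neg, sq]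
        have hmem : ∑ k ∈ S, (lam p K ^ 2 - lam k K ^ 2) • w k ∈ j := by
          have hadj : lam p K ^ 2 • (∑ k ∈ insert p S, w k) +
              ⁅(K : g), ⁅(K : g), ∑ k ∈ insert p S, w k⁆⁆ ∈ j :=
            add_mem (j.toSubmodule.smul_mem _ hwj)
              (lie_mem_right ℝ g j _ _ (lie_mem_right ℝ g j _ _ hwj))
          have heq : lam p K ^ 2 • (∑ k ∈ insert p S, w k) +
              ⁅(K : g), ⁅(K : g), ∑ k ∈ insert p S, w k⁆⁆ =
              ∑ k ∈ S, (lam p K ^ 2 - lam k K ^ 2) • w k := by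
            simp only [lie_sum, hKK, Finset.smul_sum, ← Finset.sum_add_distrib,
              ← sub_eq_add_neg, ← sub_smul]
            rw [Finset.sum_insert hp, sub_self, zero_smul, zero_add]
          rwa [heq] at hadj
        exact (smul_eq_zero.1 (ih _ (fun k => (A k).smul_mem _ (hw k)) hmem i hi)).resolve_left
          (sub_ne_zero.2 hK)
      rw [Finset.sum_insert hp, Finset.sum_eq_zero hS, add_zero] at hwj
      exact (Finset.forall_mem_insert _ _ _).2 ⟨hAj p _ (hw p) hwj, hS⟩
  rw [LieSubmodule.eq_bot_iff]
  intro x hx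
  obtain ⟨H, hH, v, hv, rfl⟩ : ∃ H ∈ h.toSubmodule, ∃ v ∈ a.toSubmodule, H + v = x :=
    Submodule.mem_sup.1 (hcompl.sup_eq_top ▸ Submodule.mem_top)
  have hlamH : ∀ i, lam i ⟨H, hH⟩ = 0 := by
    intro i
    by_contra hne
    obtain ⟨w, hw, hw0⟩ : ∃ w ∈ A i, w ≠ 0 := by
      refine (A i).exists_mem_ne_zero_of_ne_bot fun hbot => ?_
      have hd := hdim i
      rw [hbot, finrank_bot] at hd
      omega
    have hmem : ⁅H + v, w⁆ ∈ j := lie_mem_left ℝ g j _ _ hx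
    rw [add_lie, haab v hv w (hAa i hw), add_zero, hbracket i ⟨H, hH⟩ w hw] at hmem
    have hJw := hAj i _ (hJA i w hw) ((j.toSubmodule.smul_mem_iff hne).1 hmem)
    exact hw0 (by simpa [hJw] using hJ2 w (hAa i hw))
  have hH0 : (⟨H, hH⟩ : h) = 0 := by
    refine (Module.forall_dual_apply_eq_zero_iff ℝ _).1 fun f => ?_
    have hf : f ∈ Submodule.span ℝ (Set.range lam) := hspan ▸ Submodule.mem_top
    induction hf using Submodule.span_induction with
    | mem f hf => obtain ⟨i, rfl⟩ := hf; exact hlamH i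
    | zero => simp
    | add f f' _ _ hf hf' => simp [hf, hf']
    | smul c f _ hf => simp [hf]
  obtain rfl : H = 0 := congrArg Subtype.val hH0
  rw [zero_add] at hx ⊢
  rw [← hsup] at hv
  obtain ⟨w, hw, rfl⟩ := (Submodule.mem_iSup_iff_exists_finsupp A v).1 hv
  exact Finset.sum_eq_zero (hsupport w.support w hw hx)
end

section
/- Let (h, ∇) be a flat Lie algebra over a field k of characteristic 0, let ρ : h → End(h*) be defined by ρ(u)ξ = −ξ ∘ ∇_u, and let α : h × h → h* be an alternating bilinear map satisfying the 2-cocycle condition ρ(u)α(v,w) + ρ(v)α(w,u) + ρ(w)α(u,v) + α(u,[v,w]) + α(w,[u,v]) + α(v,[w,u]) = 0 for all u,v,w ∈ h. Define a bracket on the vector space g = h ⊕ h* by [u + ξ, v + η]_g = [u,v]_h + α(u,v) + ρ(u)η − ρ(v)ξ for u,v ∈ h and ξ,η ∈ h*, and define the non-degenerate alternating form ω on g by ω(u + ξ, v + η) = ξ(v) − η(u). Then [·,·]_g is a Lie bracket on g, and ω is closed for this bracket (so (g, ω) is a symplectic Lie algebra) if and only if α(u,v)(w) + α(w,u)(v)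 + α(v,w)(u) = 0 for all u, v, w ∈ h. -/
/-- Lagrangian extension of a flat Lie algebra `(h, ∇)` by a 2-cocycle
`α : h × h → h*` (with coefficients in the representation `ρ(u)ξ = -ξ ∘ ∇_u`).
The bracket `[u + ξ, v + η] = [u,v] + α(u,v) + ρ(u)η - ρ(v)ξ` on `g = h ⊕ h*` is a Lie
bracket, the pairing `ω(u + ξ, v + η) = ξ(v) - η(u)` is alternating and non-degenerate,
and `ω` is closed (so `(g, ω)` is a symplectic Lie algebra) if and only if
`α(u,v)(w) + α(w,u)(v) + α(v,w)(u) = 0` for all `u, v, w ∈ h`. -/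
theorem stmt_7 {k : Type*} [Field k] [CharZero k]
    {h : Type*} [LieRing h] [LieAlgebra k h] [Module.Finite k h]
    (nabla : h →ₗ[k] h →ₗ[k] h)
    (htf : ∀ u v : h, nabla u v - nabla v u = ⁅u, v⁆)
    (hflat : ∀ u v w : h, nabla ⁅u, v⁆ w = nabla u (nabla v w) - nabla v (nabla u w))
    (α : h →ₗ[k] h →ₗ[k] Module.Dual k h)
    (hαalt : ∀ u : h, α u u = 0)
    (hcocycle : ∀ u v w : h,
      (-((α v w).comp (nabla u))) + (-((α w u).comp (nabla v)))
          + (-((α u v).comp (nabla w)))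
        + α u ⁅v, w⁆ + α w ⁅u, v⁆ + α v ⁅w, u⁆ = 0)
    (bracket : h × Module.Dual k h → h × Module.Dual k h → h × Module.Dual k h)
    (hbr : ∀ (u v : h) (ξ η : Module.Dual k h),
      bracket (u, ξ) (v, η) =
        (⁅u, v⁆, α u v + (-(η.comp (nabla u))) - (-(ξ.comp (nabla v)))))
    (Ω : h × Module.Dual k h → h × Module.Dual k h → k)
    (hΩ : ∀ (u v : h) (ξ η : Module.Dual k h), Ω (u, ξ) (v, η) = ξ v - η u) :
    (∀ x, bracket x x = 0) ∧
    (∀ x y z, bracket x (bracket y z) + bracket z (bracket x y)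
        + bracket y (bracket z x) = 0) ∧
    (∀ x, Ω x x = 0) ∧
    (∀ x, (∀ y, Ω x y = 0) → x = 0) ∧
    ((∀ x y z, Ω (bracket x y) z + Ω (bracket z x) y + Ω (bracket y z) x = 0) ↔
      (∀ u v w : h, α u v w + α w u v + α v w u = 0)) := by
  refine ⟨?_, ?_, ?_, ?_, ?_⟩
  · rintro ⟨u, ξ⟩
    rw [hbr, lie_self, hαalt]
    simp
  · rintro ⟨u, ξ⟩ ⟨v, η⟩ ⟨w, ζ⟩
    simp only [hbr, Prod.mk_add_mk, Prod.mk_eq_zero]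
    constructor
    · have hJ := lie_jacobi u v w
      rw [← hJ]
      abel
    · ext t
      have hc := LinearMap.congr_fun (hcocycle u v w) t
      simp only [LinearMap.add_apply, LinearMap.sub_apply, LinearMap.neg_apply,
        LinearMap.comp_apply, LinearMap.zero_apply, hflat, map_sub] at hc ⊢
      linear_combination hc
  · rintro ⟨u, ξ⟩
    rw [hΩ, sub_self]
  · rintro ⟨u, ξ⟩ hx
    have hξ : ξ = 0 := by
      ext v
      simpa [hΩ] using hx (v, 0)
    have hu : u = 0 := by
      rw [← Module.forall_dual_apply_eq_zero_iff k]
      intro η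
      simpa [hΩ] using hx (0, η)
    rw [hu, hξ, Prod.mk_zero_zero]
  · constructor
    · intro hcl u v w
      simpa [hbr, hΩ] using hcl (u, 0) (v, 0) (w, 0)
    · rintro hα ⟨u, ξ⟩ ⟨v, η⟩ ⟨w, ζ⟩
      simp only [hbr, hΩ, LinearMap.add_apply, LinearMap.sub_apply, LinearMap.neg_apply,
        LinearMap.comp_apply, ← htf, map_sub]
      linear_combination hα u v w
end

section
/- Let V be a vector space over a field of characteristic 0 equipped with an alternating bilinear form ω (not necessarily non-degenerate). Let φ ∈ End(V) satisfy φ^k = 0 for some k ≥ 1 and the quadratic equation ω(φ²u, v) + 2ω(φu, φv) + ω(u, φ²v) = 0 for all u, v ∈ V. Then for every j with 0 ≤ j ≤ k, the images of φ^j and φ^{k−j} are ω-orthogonal: ω(φ^j u, φ^{k−j} v) = 0 for all u, v ∈ V. -/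
/-- A finite sequence starting at `0` and annihilated by `(S + 1)²`, where `S` is the shift, is an
alternating linear function of the index. -/
lemma eq_alternating_linear_of_recurrence {R : Type*} [CommRing R] {n : ℕ} {a : ℕ → R}
    (h0 : a 0 = 0) (hrec : ∀ i, i + 2 ≤ n → a (i + 2) + 2 * a (i + 1) + a i = 0) :
    ∀ j ≤ n, a j = (-1) ^ (j + 1) * j * a 1
  | 0, _ => by simp [h0]
  | 1, _ => by simp
  | j + 2, hj => by
    have h₁ := eq_alternating_linear_of_recurrence h0 hrec j (by lia)
    have h₂ := eq_alternating_linear_of_recurrence h0 hrec (j + 1) (by lia)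
    push_cast at h₁ h₂ ⊢
    linear_combination hrec j hj - h₁ - 2 * h₂

/-- A finite sequence vanishing at both ends and annihilated by `(S + 1)²`, where `S` is the shift,
is zero. -/
lemma eq_zero_of_recurrence {K : Type*} [Field K] [CharZero K] {n : ℕ} {a : ℕ → K}
    (h0 : a 0 = 0) (hn : a n = 0)
    (hrec : ∀ i, i + 2 ≤ n → a (i + 2) + 2 * a (i + 1) + a i = 0) {j : ℕ} (hj : j ≤ n) :
    a j = 0 := by
  rcases Nat.eq_zero_or_pos n with rfl | hpos
  · rwa [Nat.le_zero.mp hj]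
  have h1 : a 1 = 0 := by
    have h := eq_alternating_linear_of_recurrence h0 hrec n le_rfl
    simpa [hn, hpos.ne'] using h
  simp [eq_alternating_linear_of_recurrence h0 hrec j hj, h1]

/-- Let `ω` be an alternating bilinear form on a vector space `V` over a
field of characteristic 0, and let `φ` be an endomorphism with `φ^n = 0` (`n ≥ 1`)
satisfying `ω(φ²u, v) + 2ω(φu, φv) + ω(u, φ²v) = 0` for all `u, v`. Then for every
`0 ≤ j ≤ n`, the images of `φ^j` and `φ^{n-j}` are `ω`-orthogonal. -/
theorem stmt_8 {k : Type*} [Field k] [CharZero k]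
    {V : Type*} [AddCommGroup V] [Module k V]
    (ω : V →ₗ[k] V →ₗ[k] k)
    (halt : ∀ u : V, ω u u = 0)
    (φ : V →ₗ[k] V) (n : ℕ) (hn : 1 ≤ n) (hnil : φ ^ n = 0)
    (hquad : ∀ u v : V, ω (φ (φ u)) v + 2 * ω (φ u) (φ v) + ω u (φ (φ v)) = 0) :
    ∀ j ≤ n, ∀ u v : V, ω ((φ ^ j) u) ((φ ^ (n - j)) v) = 0 := by
  intro j hj u v
  refine eq_zero_of_recurrence (a := fun i => ω ((φ ^ i) u) ((φ ^ (n - i)) v)) ?_ ?_ ?_ hj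
  · simp [hnil]
  · simp [hnil]
  · intro i hi
    obtain ⟨m, rfl⟩ := Nat.exists_eq_add_of_le hi
    have e₁ : i + 2 + m - (i + 1) = m + 1 := by lia
    have e₂ : i + 2 + m - i = m + 2 := by lia
    simpa [e₁, e₂, pow_succ', Module.End.mul_apply] using hquad ((φ ^ i) u) ((φ ^ m) v)
end

section
/- Let V be a finite-dimensional vector space over a field of characteristic 0 equipped with an alternating bilinear form ω (not necessarily non-degenerate). Let φ ∈ End(V) satisfy φ^k = 0 for some k ≥ 1 and the quadratic equation ω(φ²u, v) + 2ω(φu, φv) + ω(u, φ²v) = 0 for all u, v ∈ V. Then there exists a φ-invariant Lagrangian subspace of (V, ω), i.e. a subspace L with φ(L) ⊆ L which is isotropic for ω and of maximal dimension among all isotropic subspaces of (V, ω). -/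
open Module

/-- Endomorphisms with `f * g - g * f = g ^ 2` in characteristic zero: `g` is not injective,
since otherwise `g⁻¹ * f - f * g⁻¹ = 1` would have trace zero. -/
theorem LinearMap.exists_ne_zero_of_commutator_eq_sq {k Q : Type*} [Field k] [CharZero k]
    [AddCommGroup Q] [Module k Q] [Module.Finite k Q] [Nontrivial Q] (f g : Q →ₗ[k] Q)
    (h : ∀ q, f (g q) - g (f q) = g (g q)) : ∃ q, q ≠ 0 ∧ g q = 0 := by
  by_contra! hg
  have hinj : Function.Injective g := by
    rw [injective_iff_map_eq_zero]
    intro a ha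
    by_contra hne
    exact hg a hne ha
  let e : Q ≃ₗ[k] Q := LinearEquiv.ofInjectiveEndo g hinj
  have he : ∀ q, e q = g q := fun q => rfl
  let s : Q →ₗ[k] Q := e.symm
  have hs : s * f - f * s = 1 := by
    ext q
    obtain ⟨p, rfl⟩ := e.surjective q
    have hp := h p
    apply e.injective
    simp only [s, LinearMap.sub_apply, Module.End.mul_apply, LinearEquiv.coe_coe, map_sub,
      LinearEquiv.apply_symm_apply, LinearEquiv.symm_apply_apply, Module.End.one_apply]
    simpa only [he] using hp
  have ht := congrArg (LinearMap.trace k Q) hs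
  rw [map_sub, LinearMap.trace_mul_comm, sub_self, LinearMap.trace_one] at ht
  exact (Module.finrank_pos (R := k) (M := Q)).ne' (by exact_mod_cast ht.symm)

/-- A functional vanishing on the radical of an alternating form is represented by the form. -/
theorem LinearMap.mem_range_of_forall_mem_ker {k V : Type*} [Field k] [AddCommGroup V]
    [Module k V] [Module.Finite k V] {ω : V →ₗ[k] V →ₗ[k] k} (hω : ω.IsAlt) {f : V →ₗ[k] k}
    (hf : ∀ r, ω r = 0 → f r = 0) : f ∈ LinearMap.range ω := by
  have hle : LinearMap.range ω ≤ (LinearMap.ker ω).dualAnnihilator := by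
    rintro _ ⟨v, rfl⟩
    rw [Submodule.mem_dualAnnihilator]
    intro r hr
    rw [LinearMap.mem_ker] at hr
    rw [← hω.neg, hr, LinearMap.zero_apply, neg_zero]
  have heq : LinearMap.range ω = (LinearMap.ker ω).dualAnnihilator := by
    refine Submodule.eq_of_le_of_finrank_eq hle ?_
    have h₁ := LinearMap.finrank_range_add_finrank_ker ω
    have h₂ := Subspace.finrank_add_finrank_dualAnnihilator_eq (LinearMap.ker ω)
    exact Nat.add_left_cancel (((add_comm _ _).trans h₁).trans h₂.symm)
  rw [heq, Submodule.mem_dualAnnihilator]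
  exact fun r hr => hf r hr

/-- An isotropic subspace containing its own orthogonal has maximal dimension among the
isotropic subspaces. -/
theorem LinearMap.IsAlt.finrank_le_of_orthogonal_le {k V : Type*} [Field k] [AddCommGroup V]
    [Module k V] [Module.Finite k V] {ω : V →ₗ[k] V →ₗ[k] k} (hω : ω.IsAlt) {L L' : Submodule k V}
    (hL : ∀ v, (∀ w ∈ L, ω w v = 0) → v ∈ L) (hL' : ∀ x ∈ L', ∀ y ∈ L', ω x y = 0) :
    finrank k L' ≤ finrank k L := by
  let B : LinearMap.BilinForm k V := ω
  have hrefl : B.IsRefl := hω.isRefl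
  have h₁ := LinearMap.BilinForm.finrank_add_finrank_orthogonal hrefl L
  have h₂ := LinearMap.BilinForm.finrank_add_finrank_orthogonal hrefl L'
  have h₃ : finrank k (B.orthogonal L) ≤ finrank k L :=
    Submodule.finrank_mono fun v hv => hL v (LinearMap.BilinForm.mem_orthogonal_iff.1 hv)
  have h₄ : finrank k L' ≤ finrank k (B.orthogonal L') :=
    Submodule.finrank_mono fun v hv =>
      LinearMap.BilinForm.mem_orthogonal_iff.2 fun w hw => hL' w hw v hv
  have h₅ : finrank k (L' ⊓ B.orthogonal ⊤ : Submodule k V) ≤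
      finrank k (L ⊓ B.orthogonal ⊤ : Submodule k V) := by
    refine Submodule.finrank_mono fun v hv => ⟨hL v fun w _ => ?_, hv.2⟩
    exact LinearMap.BilinForm.mem_orthogonal_iff.1 hv.2 w trivial
  omega

/-- `φ`-invariant `ω`-isotropic subspaces which contain the radical of `ω` and on which every
functional `η w` is represented through `ω` by an element of the subspace. -/
structure IsAdmissible {k V : Type*} [Field k] [AddCommGroup V] [Module k V]
    (ω η : V →ₗ[k] V →ₗ[k] k) (φ : V →ₗ[k] V) (W : Submodule k V) : Prop where
  radical_mem : ∀ r, ω r = 0 → r ∈ W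
  map_mem : ∀ w ∈ W, φ w ∈ W
  isotropic : ∀ x ∈ W, ∀ y ∈ W, ω x y = 0
  exists_lift : ∀ w ∈ W, ∃ w' ∈ W, η w = ω w'

section

variable {k V : Type*} [Field k] [AddCommGroup V] [Module k V]
  {ω η : V →ₗ[k] V →ₗ[k] k} {φ : V →ₗ[k] V}

theorem apply_pow_succ_of_radical (hη : ∀ u v, η u v = ω (φ u) v + ω u (φ v))
    (hφ : ∀ u v, η (φ u) v = -η u (φ v)) {r : V} (hr : ω r = 0) (i : ℕ) (v : V) :
    ω ((φ ^ (i + 1)) r) v = (i + 1) * η ((φ ^ i) r) v := by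
  induction i generalizing v with
  | zero => simp [hη, hr]
  | succ i ih =>
    rw [pow_succ' φ (i + 1), Module.End.mul_apply]
    have h₁ := hη ((φ ^ (i + 1)) r) v
    have h₂ := ih (φ v)
    have h₃ := hφ ((φ ^ i) r) v
    rw [← Module.End.mul_apply, ← pow_succ'] at h₃
    push_cast
    linear_combination -h₁ - h₂ - (i + 1) * h₃

theorem isAdmissible_span_pow_radical [CharZero k] (hω : ω.IsAlt)
    (hη : ∀ u v, η u v = ω (φ u) v + ω u (φ v)) (hφ : ∀ u v, η (φ u) v = -η u (φ v)) :
    IsAdmissible ω η φ (Submodule.span k {x | ∃ i r, ω r = 0 ∧ x = (φ ^ i) r}) where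
  radical_mem r hr := Submodule.subset_span ⟨0, r, hr, by simp⟩
  map_mem w hw := by
    induction hw using Submodule.span_induction with
    | mem x hx =>
      obtain ⟨i, r, hr, rfl⟩ := hx
      exact Submodule.subset_span ⟨i + 1, r, hr, by rw [pow_succ', Module.End.mul_apply]⟩
    | zero => simp
    | add x y _ _ hx hy => rw [map_add]; exact add_mem hx hy
    | smul a x _ hx => rw [map_smul]; exact Submodule.smul_mem _ _ hx
  exists_lift w hw := by
    induction hw using Submodule.span_induction with
    | mem x hx =>
      obtain ⟨i, r, hr, rfl⟩ := hx
      refine ⟨(i + 1 : k)⁻¹ • (φ ^ (i + 1)) r,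
        Submodule.smul_mem _ _ (Submodule.subset_span ⟨i + 1, r, hr, rfl⟩), ?_⟩
      ext v
      rw [map_smul, LinearMap.smul_apply, apply_pow_succ_of_radical hη hφ hr, smul_eq_mul,
        inv_mul_cancel_left₀ (by exact_mod_cast i.succ_ne_zero)]
    | zero => exact ⟨0, zero_mem _, by simp⟩
    | add x y _ _ hx hy =>
      obtain ⟨x', hx', hx⟩ := hx
      obtain ⟨y', hy', hy⟩ := hy
      exact ⟨x' + y', add_mem hx' hy', by rw [map_add, map_add, hx, hy]⟩
    | smul a x _ hx =>
      obtain ⟨x', hx', hx⟩ := hx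
      exact ⟨a • x', Submodule.smul_mem _ _ hx', by rw [map_smul, map_smul, hx]⟩
  isotropic := by
    have hη_rad : ∀ (r s : V), ω r = 0 → ω s = 0 → ∀ m, η ((φ ^ m) s) r = 0 := by
      intro r s hr hs m
      have h := apply_pow_succ_of_radical hη hφ hs m r
      rw [← hω.neg, hr, LinearMap.zero_apply, neg_zero, eq_comm, mul_eq_zero] at h
      exact h.resolve_left (by exact_mod_cast m.succ_ne_zero)
    have hη_pow : ∀ (r s : V), ω r = 0 → ω s = 0 → ∀ j i, η ((φ ^ i) r) ((φ ^ j) s) = 0 := by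
      intro r s hr hs j
      induction j with
      | zero => intro i; simpa using hη_rad s r hs hr i
      | succ j ih =>
        intro i
        have h := ih (i + 1)
        rw [pow_succ', Module.End.mul_apply, hφ, neg_eq_zero] at h
        rwa [pow_succ' φ j, Module.End.mul_apply]
    intro x hx y hy
    induction hx, hy using Submodule.span_induction₂ with
    | mem_mem x y hx hy =>
      obtain ⟨i, r, hr, rfl⟩ := hx
      obtain ⟨j, s, hs, rfl⟩ := hy
      cases i with
      | zero => simp [hr]
      | succ i => rw [apply_pow_succ_of_radical hη hφ hr, hη_pow r s hr hs, mul_zero]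
    | zero_left => simp
    | zero_right => simp
    | add_left _ _ _ _ _ _ h₁ h₂ => simp [h₁, h₂]
    | add_right _ _ _ _ _ _ h₁ h₂ => simp [h₁, h₂]
    | smul_left _ _ _ _ _ h => simp [h]
    | smul_right _ _ _ _ _ h => simp [h]

namespace IsAdmissible

variable {W : Submodule k V}

theorem eta_apply_eq_zero (hW : IsAdmissible ω η φ W) (hη : ∀ u v, η u v = -η v u) {v w : V}
    (hv : ∀ w ∈ W, ω w v = 0) (hw : w ∈ W) : η v w = 0 := by
  obtain ⟨w', hw', h⟩ := hW.exists_lift w hw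
  rw [hη, h, hv w' hw', neg_zero]

/-- Outside an admissible subspace, its orthogonal contains a vector `v` such that `η v` is
represented through `ω` by an element of the subspace. -/
theorem exists_lift_notMem [CharZero k] [Module.Finite k V] (hW : IsAdmissible ω η φ W)
    (hω : ω.IsAlt) (hη : ∀ u v, η u v = ω (φ u) v + ω u (φ v))
    (hφ : ∀ u v, η (φ u) v = -η u (φ v)) (hη_symm : ∀ u v, η u v = -η v u) {v : V}
    (hv : ∀ w ∈ W, ω w v = 0) (hvW : v ∉ W) :
    ∃ u, u ∉ W ∧ (∀ w ∈ W, ω w u = 0) ∧ ∃ w ∈ W, η u = ω w := by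
  let P : Submodule k V :=
    { carrier := {u | ∀ w ∈ W, ω w u = 0}
      zero_mem' := fun w _ => map_zero _
      add_mem' := fun {a b} ha hb w hw => by rw [map_add, ha w hw, hb w hw, add_zero]
      smul_mem' := fun c a ha w hw => by rw [map_smul, ha w hw, smul_zero] }
  have hP : ∀ u, u ∈ P ↔ ∀ w ∈ W, ω w u = 0 := fun u => Iff.rfl
  have hφP : ∀ u ∈ P, φ u ∈ P := by
    intro u hu w hw
    have h₁ := hW.eta_apply_eq_zero hη_symm hu hw
    rw [hη_symm, hη, hu _ (hW.map_mem w hw), zero_add, neg_eq_zero] at h₁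
    exact h₁
  have hrange : ∀ u ∈ P, η u ∈ LinearMap.range ω := fun u hu =>
    LinearMap.mem_range_of_forall_mem_ker hω fun r hr =>
      hW.eta_apply_eq_zero hη_symm hu (hW.radical_mem r hr)
  obtain ⟨T₀, hT₀⟩ := Module.projective_lifting_property ω.rangeRestrict
    ((η ∘ₗ P.subtype).codRestrict (LinearMap.range ω) fun u => hrange u u.2)
    ω.surjective_rangeRestrict
  have hT₀' : ∀ u : P, ω (T₀ u) = η u := fun u =>
    congrArg Subtype.val (LinearMap.congr_fun hT₀ u)
  let T : P →ₗ[k] P := T₀.codRestrict P fun u w hw => by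
    rw [← hω.neg, hT₀', hW.eta_apply_eq_zero hη_symm u.2 hw, neg_zero]
  have hT : ∀ u : P, ω (T u : V) = η u := hT₀'
  let F : P →ₗ[k] P := φ.restrict hφP
  have hF : ∀ u : P, (F u : V) = φ u := fun u => rfl
  let N : Submodule k P := W.comap P.subtype
  have hN : ∀ u : P, u ∈ N ↔ (u : V) ∈ W := fun u => Iff.rfl
  have hFN : N ≤ N.comap F := fun u hu => hW.map_mem u hu
  have hTN : N ≤ N.comap T := by
    intro u hu
    obtain ⟨w, hw, h⟩ := hW.exists_lift u hu
    have h₁ : (T u : V) - w ∈ W := hW.radical_mem _ (by rw [map_sub, hT, h, sub_self])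
    rw [Submodule.mem_comap, hN, ← sub_add_cancel (T u : V) w]
    exact add_mem h₁ hw
  have hcomm : ∀ u : P, F (T u) - T (F u) - T (T u) ∈ N := by
    intro u
    refine hW.radical_mem _ ?_
    ext x
    have h₁ := hη (T u) x
    have h₂ := hφ u x
    simp only [map_sub, Submodule.subtype_apply, hF, hT, LinearMap.sub_apply,
      LinearMap.zero_apply] at h₁ ⊢
    linear_combination -h₁ - h₂
  have : Nontrivial (P ⧸ N) :=
    Submodule.Quotient.nontrivial_iff.2 fun h => hvW ((hN ⟨v, hv⟩).1 (h ▸ trivial))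
  obtain ⟨q, hq, hTq⟩ := LinearMap.exists_ne_zero_of_commutator_eq_sq (N.mapQ N F hFN)
    (N.mapQ N T hTN) (by
      intro q
      obtain ⟨u, rfl⟩ := N.mkQ_surjective q
      simp only [Submodule.mkQ_apply, Submodule.mapQ_apply]
      rw [← sub_eq_zero, ← Submodule.Quotient.mk_sub, ← Submodule.Quotient.mk_sub,
        Submodule.Quotient.mk_eq_zero]
      exact hcomm u)
  obtain ⟨u, rfl⟩ := N.mkQ_surjective q
  rw [Submodule.mkQ_apply, ne_eq, Submodule.Quotient.mk_eq_zero] at hq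
  rw [Submodule.mkQ_apply, Submodule.mapQ_apply, Submodule.Quotient.mk_eq_zero] at hTq
  exact ⟨u, hq, u.2, T u, hTq, (hT u).symm⟩

/-- An admissible subspace which does not contain its orthogonal can be enlarged. -/
theorem exists_gt [CharZero k] [Module.Finite k V] (hW : IsAdmissible ω η φ W)
    (hω : ω.IsAlt) (hη : ∀ u v, η u v = ω (φ u) v + ω u (φ v))
    (hφ : ∀ u v, η (φ u) v = -η u (φ v)) (hη_symm : ∀ u v, η u v = -η v u)
    (hnil : IsNilpotent φ) {v : V} (hv : ∀ w ∈ W, ω w v = 0) (hvW : v ∉ W) :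
    ∃ W', W < W' ∧ IsAdmissible ω η φ W' := by
  obtain ⟨u, huW, hu, hlift⟩ := hW.exists_lift_notMem hω hη hφ hη_symm hv hvW
  have hstep : ∀ x, (∀ w ∈ W, ω w x = 0) ∧ (∃ w ∈ W, η x = ω w) →
      (∀ w ∈ W, ω w (φ x) = 0) ∧ ∃ w ∈ W, η (φ x) = ω w := by
    rintro x ⟨hx, w, hw, hxw⟩
    constructor
    · intro y hy
      have h := hW.eta_apply_eq_zero hη_symm hx hy
      rwa [hη_symm, hη, hx _ (hW.map_mem y hy), zero_add, neg_eq_zero] at h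
    · obtain ⟨w', hw', h⟩ := hW.exists_lift w hw
      refine ⟨φ w - w', sub_mem (hW.map_mem w hw) hw', ?_⟩
      ext y
      rw [hφ, hxw, map_sub, LinearMap.sub_apply, ← h, hη]
      ring
  have hpow : ∀ i, (∀ w ∈ W, ω w ((φ ^ i) u) = 0) ∧ ∃ w ∈ W, η ((φ ^ i) u) = ω w := by
    intro i
    induction i with
    | zero => exact ⟨hu, hlift⟩
    | succ i ih => rw [pow_succ', Module.End.mul_apply]; exact hstep _ ih
  obtain ⟨x, hxW, hφx, hx, w₀, hw₀, hxw₀⟩ :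
      ∃ x, x ∉ W ∧ φ x ∈ W ∧ (∀ w ∈ W, ω w x = 0) ∧ ∃ w ∈ W, η x = ω w := by
    classical
    obtain ⟨n, hn⟩ := hnil
    have hex : ∃ i, (φ ^ i) u ∈ W := ⟨n, by simp [hn]⟩
    obtain ⟨m, hm⟩ : ∃ m, Nat.find hex = m + 1 := Nat.exists_eq_succ_of_ne_zero fun h => by
      have := Nat.find_spec hex
      rw [h] at this
      exact huW this
    refine ⟨(φ ^ m) u, Nat.find_min hex (by omega), ?_, hpow m⟩
    have := Nat.find_spec hex
    rwa [hm, pow_succ', Module.End.mul_apply] at this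
  refine ⟨W ⊔ Submodule.span k {x}, ?_, ?_, ?_, ?_, ?_⟩
  · exact left_lt_sup.2 fun h => hxW (h (Submodule.mem_span_singleton_self x))
  · exact fun r hr => Submodule.mem_sup_left (hW.radical_mem r hr)
  · intro y hy
    obtain ⟨w, hw, _, hz, rfl⟩ := Submodule.mem_sup.1 hy
    obtain ⟨c, rfl⟩ := Submodule.mem_span_singleton.1 hz
    rw [map_add, map_smul]
    exact Submodule.mem_sup_left (add_mem (hW.map_mem w hw) (W.smul_mem c hφx))
  · intro y hy z hz
    obtain ⟨w, hw, _, hy', rfl⟩ := Submodule.mem_sup.1 hy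
    obtain ⟨c, rfl⟩ := Submodule.mem_span_singleton.1 hy'
    obtain ⟨w', hw', _, hz', rfl⟩ := Submodule.mem_sup.1 hz
    obtain ⟨d, rfl⟩ := Submodule.mem_span_singleton.1 hz'
    have h : ω x w' = 0 := by rw [← hω.neg, hx w' hw', neg_zero]
    simp [hx w hw, h, hW.isotropic w hw w' hw', hω x]
  · intro y hy
    obtain ⟨w, hw, _, hz, rfl⟩ := Submodule.mem_sup.1 hy
    obtain ⟨c, rfl⟩ := Submodule.mem_span_singleton.1 hz
    obtain ⟨w', hw', h⟩ := hW.exists_lift w hw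
    refine ⟨w' + c • w₀, Submodule.mem_sup_left (add_mem hw' (W.smul_mem c hw₀)), ?_⟩
    rw [map_add, map_add, map_smul, map_smul, h, hxw₀]

end IsAdmissible

end


/-- Let `ω` be an alternating bilinear form on a finite-dimensional vector
space `V` over a field of characteristic 0, and `φ` an endomorphism with `φ^n = 0`
(`n ≥ 1`) satisfying `ω(φ²u, v) + 2ω(φu, φv) + ω(u, φ²v) = 0` for all `u, v`. Then there
is a `φ`-invariant Lagrangian subspace of `(V, ω)`: a `φ`-invariant isotropic subspace of
maximal dimension among all isotropic subspaces. -/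
theorem stmt_9 {k : Type*} [Field k] [CharZero k]
    {V : Type*} [AddCommGroup V] [Module k V] [Module.Finite k V]
    (ω : V →ₗ[k] V →ₗ[k] k)
    (halt : ∀ u : V, ω u u = 0)
    (φ : V →ₗ[k] V) (n : ℕ) (hn : 1 ≤ n) (hnil : φ ^ n = 0)
    (hquad : ∀ u v : V, ω (φ (φ u)) v + 2 * ω (φ u) (φ v) + ω u (φ (φ v)) = 0) :
    ∃ L : Submodule k V,
      (∀ x ∈ L, φ x ∈ L) ∧
      (∀ x ∈ L, ∀ y ∈ L, ω x y = 0) ∧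
      (∀ L' : Submodule k V, (∀ x ∈ L', ∀ y ∈ L', ω x y = 0) →
        Module.finrank k L' ≤ Module.finrank k L) := by
  let η : V →ₗ[k] V →ₗ[k] k := ω ∘ₗ φ + ω.compl₂ φ
  have hω : ω.IsAlt := halt
  have hη : ∀ u v, η u v = ω (φ u) v + ω u (φ v) := fun u v => rfl
  have hφ : ∀ u v, η (φ u) v = -η u (φ v) := by
    intro u v
    rw [hη, hη]
    linear_combination hquad u v
  have hη_symm : ∀ u v, η u v = -η v u := by
    intro u v
    rw [hη, hη, ← hω.neg v (φ u), ← hω.neg u (φ v)]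
    ring
  obtain ⟨L, hL⟩ := exists_maximal_of_wellFoundedGT (IsAdmissible ω η φ)
    ⟨_, isAdmissible_span_pow_radical hω hη hφ⟩
  refine ⟨L, hL.prop.map_mem, hL.prop.isotropic, fun L' hL' =>
    hω.finrank_le_of_orthogonal_le (fun v hv => ?_) hL'⟩
  by_contra hvL
  obtain ⟨W, hlt, hW⟩ := hL.prop.exists_gt hω hη hφ hη_symm ⟨n, hnil⟩ hv hvL
  exact hL.not_prop_of_gt hlt hW
end

section
/- Let (V, ω) be a symplectic vector space of dimension at most four over a field of characteristic 0, and let q ⊆ End(V) be a subspace of endomorphisms such that φ ∘ ψ = 0 for all φ, ψ ∈ q (so q is an abelian quadratic Lie subalgebra of End(V)) and such that the image of each φ ∈ q is isotropic, i.e. ω(φu, φv) = 0 for all φ ∈ q and all u, v ∈ V. Then there exists a Lagrangian subspace a of (V, ω) which is q-invariant: φ(a) ⊆ a for all φ ∈ q. -/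
/-- In a symplectic vector space every isotropic subspace lies in a Lagrangian subspace. -/
theorem exists_lagrangian_ge {k V : Type*} [Field k] [AddCommGroup V] [Module k V]
    [Module.Finite k V] (ω : V →ₗ[k] V →ₗ[k] k) (halt : ∀ u : V, ω u u = 0)
    (hnondeg : ∀ u : V, (∀ v : V, ω u v = 0) → u = 0) (W : Submodule k V)
    (hW : ∀ x ∈ W, ∀ y ∈ W, ω x y = 0) :
    ∃ a : Submodule k V, W ≤ a ∧ (∀ x ∈ a, ∀ y ∈ a, ω x y = 0) ∧
      2 * Module.finrank k a = Module.finrank k V := by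
  have hrefl : ∀ x y, ω x y = 0 → ω y x = 0 := LinearMap.IsAlt.isRefl (B := ω) halt
  obtain ⟨a, ⟨hWa, ha⟩, hmax⟩ := (wellFounded_gt (α := Submodule k V)).has_min
    {a | W ≤ a ∧ ∀ x ∈ a, ∀ y ∈ a, ω x y = 0} ⟨W, le_rfl, hW⟩
  refine ⟨a, hWa, ha, ?_⟩
  have horth : LinearMap.BilinForm.orthogonal ω a = a := by
    refine le_antisymm (fun x hx => ?_) fun x hx n hn => ha n hn x hx
    replace hx : ∀ n ∈ a, ω n x = 0 := hx
    by_contra hxa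
    refine hmax (a ⊔ Submodule.span k {x}) ⟨hWa.trans le_sup_left, fun u hu v hv => ?_⟩ ?_
    · obtain ⟨u, hu', _, hs, rfl⟩ := Submodule.mem_sup.1 hu
      obtain ⟨v, hv', _, ht, rfl⟩ := Submodule.mem_sup.1 hv
      obtain ⟨c, rfl⟩ := Submodule.mem_span_singleton.1 hs
      obtain ⟨d, rfl⟩ := Submodule.mem_span_singleton.1 ht
      simp [ha u hu' v hv', hx u hu', hrefl _ _ (hx v hv'), halt]
    · refine lt_of_le_of_ne le_sup_left fun h => hxa ?_
      rw [h]
      exact Submodule.mem_sup_right (Submodule.mem_span_singleton_self x)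
  have hker : LinearMap.ker ω = ⊥ :=
    LinearMap.ker_eq_bot'.2 fun u hu => hnondeg u fun v => by simp [hu]
  have hrank := LinearMap.BilinForm.finrank_add_finrank_orthogonal' (B := ω) a
  rw [horth, hker, inf_bot_eq, finrank_bot] at hrank
  lia

/-- If `φ`, `ψ` and `φ + ψ` have rank at most one, then `ker φ ≤ ker ψ` or the image of `ψ` is
contained in the image of `φ`. -/
theorem exists_smul_of_rank_le_one {k V V' : Type*} [Field k] [AddCommGroup V] [Module k V]
    [AddCommGroup V'] [Module k V'] {φ ψ : V →ₗ[k] V'}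
    (hψ : ∀ x y, ψ x ≠ 0 → ∃ c : k, c • ψ x = ψ y)
    (hadd : ∀ x y, (φ + ψ) x ≠ 0 → ∃ c : k, c • (φ + ψ) x = (φ + ψ) y)
    {x z : V} (hx : φ x ≠ 0) (hz : φ z = 0) (hψz : ψ z ≠ 0) (y : V) :
    ∃ c : k, c • φ x = ψ y := by
  obtain ⟨c, hc⟩ := hadd z x (by simpa [hz] using hψz)
  obtain ⟨d, hd⟩ := hψ z x hψz
  obtain ⟨e, he⟩ := hψ z y hψz
  simp only [LinearMap.add_apply, hz, zero_add] at hc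
  have hφx : φ x = (c - d) • ψ z := by rw [sub_smul, hc, hd, add_sub_cancel_right]
  have hcd : c - d ≠ 0 := fun h => hx (by rw [hφx, h, zero_smul])
  exact ⟨e * (c - d)⁻¹, by rw [hφx, smul_smul, inv_mul_cancel_right₀ hcd, he]⟩

/-- A linear space of maps of rank at most one has a common line containing all images, or a
nonzero member whose kernel is killed by the whole space. -/
theorem common_image_or_common_kernel {k V V' : Type*} [Field k] [AddCommGroup V] [Module k V]
    [AddCommGroup V'] [Module k V'] (q : Submodule k (V →ₗ[k] V'))
    (hq : ∀ φ ∈ q, ∀ x y, φ x ≠ 0 → ∃ c : k, c • φ x = φ y) :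
    (∃ e : V', ∀ φ ∈ q, ∀ y, φ y ∈ Submodule.span k {e}) ∨
      ∃ φ ∈ q, φ ≠ 0 ∧ ∀ ψ ∈ q, LinearMap.ker φ ≤ LinearMap.ker ψ := by
  by_contra! hcon
  obtain ⟨himage, hkernel⟩ := hcon
  have key : ∀ φ ∈ q, ∀ ψ ∈ q, ∀ x z, φ x ≠ 0 → φ z = 0 → ψ z ≠ 0 → ∀ y,
      ∃ c : k, c • φ x = ψ y := fun φ hφ ψ hψ x z hx hz hψz y =>
    exists_smul_of_rank_le_one (hq ψ hψ) (hq _ (q.add_mem hφ hψ)) hx hz hψz y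
  obtain ⟨φ, hφ, x, hx⟩ := himage 0
  replace hx : φ x ≠ 0 := by simpa using hx
  obtain ⟨ψ, hψ, y, hy⟩ := himage (φ x)
  have hy' : ¬∃ c : k, c • φ x = ψ y := fun h => hy (Submodule.mem_span_singleton.2 h)
  have hψy : ψ y ≠ 0 := fun h => hy (by simp [h])
  obtain ⟨χ, hχ, hker⟩ := hkernel φ hφ fun h => hx (by simp [h])
  obtain ⟨z, hz, hχz⟩ := SetLike.not_le_iff_exists.1 hker
  replace hz : φ z = 0 := hz
  replace hχz : χ z ≠ 0 := hχz
  have hψz : ψ z = 0 := by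
    by_contra hψz
    exact hy' (key φ hφ ψ hψ x z hx hz hψz y)
  obtain ⟨c, hc⟩ := key φ hφ χ hχ x z hx hz hχz z
  obtain ⟨d, hd⟩ := key ψ hψ χ hχ y z hψy hψz hχz z
  have hd0 : d ≠ 0 := fun h => hχz (by rw [← hd, h, zero_smul])
  exact hy' ⟨d⁻¹ * c, by rw [mul_smul, hc, ← hd, inv_smul_smul₀ hd0]⟩


/-- Let `(V, ω)` be a symplectic vector space of dimension at most four over
a field of characteristic 0, and `q ⊆ End(V)` a subspace of endomorphisms with `φ ∘ ψ = 0`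
for all `φ, ψ ∈ q` (an abelian quadratic subalgebra) such that the image of each `φ ∈ q`
is isotropic. Then there is a `q`-invariant Lagrangian subspace of `(V, ω)`. -/
theorem stmt_10 {k : Type*} [Field k] [CharZero k]
    {V : Type*} [AddCommGroup V] [Module k V] [Module.Finite k V]
    (ω : V →ₗ[k] V →ₗ[k] k)
    (halt : ∀ u : V, ω u u = 0)
    (hnondeg : ∀ u : V, (∀ v : V, ω u v = 0) → u = 0)
    (hdim : Module.finrank k V ≤ 4)
    (q : Submodule k (V →ₗ[k] V))
    (hquad : ∀ φ ∈ q, ∀ ψ ∈ q, φ ∘ₗ ψ = 0)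
    (hiso : ∀ φ ∈ q, ∀ u v : V, ω (φ u) (φ v) = 0) :
    ∃ a : Submodule k V,
      (∀ x ∈ a, ∀ y ∈ a, ω x y = 0) ∧
      2 * Module.finrank k a = Module.finrank k V ∧
      (∀ φ ∈ q, ∀ x ∈ a, φ x ∈ a) := by
  by_cases hq : ∀ φ ∈ q, ∀ x y, φ x ≠ 0 → ∃ c : k, c • φ x = φ y
  · obtain ⟨e, he⟩ | ⟨φ, hφ, hφ0, hker⟩ := common_image_or_common_kernel q hq
    · obtain ⟨a, hea, ha, hrank⟩ := exists_lagrangian_ge ω halt hnondeg (Submodule.span k {e}) (by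
        intro x hx y hy
        obtain ⟨c, rfl⟩ := Submodule.mem_span_singleton.1 hx
        obtain ⟨d, rfl⟩ := Submodule.mem_span_singleton.1 hy
        simp [halt])
      exact ⟨a, ha, hrank, fun φ hφ x _ => hea (he φ hφ x)⟩
    · obtain ⟨x, hx⟩ := DFunLike.exists_ne hφ0
      replace hx : φ x ≠ 0 := hx
      obtain ⟨g, hg⟩ := Module.Projective.exists_dual_ne_zero k hx
      have hsurj : Function.Surjective ω :=
        (LinearMap.injective_iff_surjective_of_finrank_eq_finrank
          Subspace.dual_finrank_eq.symm).1
          (LinearMap.ker_eq_bot.1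
            (LinearMap.ker_eq_bot'.2 fun u hu => hnondeg u fun v => by simp [hu]))
      obtain ⟨h, hh⟩ := hsurj (g ∘ₗ φ)
      obtain ⟨a, hea, ha, hrank⟩ := exists_lagrangian_ge ω halt hnondeg (Submodule.span k {h}) (by
        intro x hx y hy
        obtain ⟨c, rfl⟩ := Submodule.mem_span_singleton.1 hx
        obtain ⟨d, rfl⟩ := Submodule.mem_span_singleton.1 hy
        simp [halt])
      refine ⟨a, ha, hrank, fun ψ hψ y hy => ?_⟩
      have hgy : g (φ y) = 0 := by
        have hωy := ha h (hea (Submodule.mem_span_singleton_self h)) y hy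
        rwa [hh] at hωy
      obtain ⟨c, hc⟩ := hq φ hφ x y hx
      have hc0 : c = 0 := by
        rw [← hc, map_smul, smul_eq_mul] at hgy
        exact (mul_eq_zero.1 hgy).resolve_right hg
      have hφy : φ y = 0 := by rw [← hc, hc0, zero_smul]
      have hψy : ψ y = 0 := hker ψ hψ hφy
      rw [hψy]
      exact a.zero_mem
  · push Not at hq
    obtain ⟨φ, hφ, x, y, hx, hxy⟩ := hq
    have hrange : ∀ u ∈ LinearMap.range φ, ∀ v ∈ LinearMap.range φ, ω u v = 0 := by
      rintro _ ⟨u, rfl⟩ _ ⟨v, rfl⟩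
      exact hiso φ hφ u v
    obtain ⟨a, hle, ha, hrank⟩ := exists_lagrangian_ge ω halt hnondeg _ hrange
    have hind : LinearIndependent k ![φ x, φ y] := (LinearIndependent.pair_iff' hx).2 hxy
    have htwo : 2 ≤ Module.finrank k (LinearMap.range φ) := by
      have hspan := finrank_span_eq_card hind
      rw [Fintype.card_fin] at hspan
      refine hspan.ge.trans ?_
      refine Submodule.finrank_mono (Submodule.span_le.2 ?_)
      rintro _ ⟨i, rfl⟩
      fin_cases i
      exacts [⟨x, rfl⟩, ⟨y, rfl⟩]
    have heq : LinearMap.range φ = a := Submodule.eq_of_le_of_finrank_le hle (by lia)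
    refine ⟨a, ha, hrank, fun ψ hψ v hv => ?_⟩
    rw [← heq] at hv
    obtain ⟨u, rfl⟩ := hv
    have hzero : ψ (φ u) = 0 := LinearMap.congr_fun (hquad ψ hψ φ hφ) u
    rw [hzero]
    exact a.zero_mem
end

section
/- Let V₆ be a six-dimensional real vector space with basis {u₁, u₂, v₁, v₂, w₁, w₂}, and let S be a symmetric invertible real 2×2 matrix. Let ω be the symplectic form on V₆ determined by: ω(v_i, v_j) = ω(w_i, w_j) = 0, ω(u_i, v_j) = ω(u_i, w_j) = 0 for all i, j, ω(u₁, u₂) ≠ 0, and ω(v_i, w_j) = S_{ij}. Define X, Y ∈ End(V₆) by X u_i = v_i, Y u_i = w_i (i = 1, 2) and X and Y vanish on v₁, v₂, w₁, w₂. Then there exists a Lagrangian subspace a of (V₆, ω) with X(a) ⊆ a and Y(a) ⊆ a if and only if det S < 0. -/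
noncomputable section

/-- The six-dimensional real vector space `V₆`. -/
abbrev V6 : Type := Fin 6 → ℝ

/-- The basis vectors `u₁, u₂` of `V₆`. -/
def uu (i : Fin 2) : V6 := Pi.single (⟨i.1, by have := i.2; omega⟩ : Fin 6) 1

/-- The basis vectors `v₁, v₂` of `V₆`. -/
def vv (i : Fin 2) : V6 := Pi.single (⟨i.1 + 2, by have := i.2; omega⟩ : Fin 6) 1

/-- The basis vectors `w₁, w₂` of `V₆`. -/
def ww (i : Fin 2) : V6 := Pi.single (⟨i.1 + 4, by have := i.2; omega⟩ : Fin 6) 1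

/-- Every vector of `V₆` expanded in the basis `u₁, u₂, v₁, v₂, w₁, w₂`. -/
theorem V6_expand (x : V6) :
    x = x 0 • uu 0 + x 1 • uu 1 + x 2 • vv 0 + x 3 • vv 1 + x 4 • ww 0 + x 5 • ww 1 := by
  ext i
  fin_cases i <;> simp [uu, vv, ww]

theorem alternating_swap (ω : V6 →ₗ[ℝ] V6 →ₗ[ℝ] ℝ) (halt : ∀ x : V6, ω x x = 0) (x y : V6) :
    ω x y = -ω y x := by
  have h := halt (x + y)
  simp only [map_add, LinearMap.add_apply, halt] at h
  linarith

/-- Coordinate formula for the symplectic form. -/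
theorem symplectic_apply (S : Matrix (Fin 2) (Fin 2) ℝ)
    (ω : V6 →ₗ[ℝ] V6 →ₗ[ℝ] ℝ)
    (halt : ∀ x : V6, ω x x = 0)
    (hvv : ∀ i j, ω (vv i) (vv j) = 0)
    (hww : ∀ i j, ω (ww i) (ww j) = 0)
    (huv : ∀ i j, ω (uu i) (vv j) = 0)
    (huw : ∀ i j, ω (uu i) (ww j) = 0)
    (hvw : ∀ i j, ω (vv i) (ww j) = S i j) (x y : V6) :
    ω x y = ω (uu 0) (uu 1) * (x 0 * y 1 - x 1 * y 0)
      + (x 2 * S 0 0 * y 4 + x 2 * S 0 1 * y 5 + x 3 * S 1 0 * y 4 + x 3 * S 1 1 * y 5)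
      - (y 2 * S 0 0 * x 4 + y 2 * S 0 1 * x 5 + y 3 * S 1 0 * x 4 + y 3 * S 1 1 * x 5) := by
  have hvu : ∀ i j, ω (vv i) (uu j) = 0 := fun i j => by
    rw [alternating_swap ω halt, huv, neg_zero]
  have hwu : ∀ i j, ω (ww i) (uu j) = 0 := fun i j => by
    rw [alternating_swap ω halt, huw, neg_zero]
  have hwv : ∀ i j, ω (ww i) (vv j) = -S j i := fun i j => by
    rw [alternating_swap ω halt, hvw]
  have hu10 : ω (uu 1) (uu 0) = -ω (uu 0) (uu 1) := alternating_swap ω halt _ _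
  conv_lhs => rw [V6_expand x, V6_expand y]
  simp only [map_add, map_smul, LinearMap.add_apply, LinearMap.smul_apply, smul_eq_mul, halt,
    hvv, hww, huv, huw, hvw, hvu, hwu, hwv, hu10]
  ring

/-- A binary quadratic form of negative discriminant (in the sense `a c - b² < 0`) has a nonzero
isotropic vector. -/
theorem exists_isotropic_of_det_neg {a b c : ℝ} (h : a * c - b * b < 0) :
    ∃ p q : ℝ, (p ≠ 0 ∨ q ≠ 0) ∧ a * p ^ 2 + 2 * b * p * q + c * q ^ 2 = 0 := by
  by_cases ha : a = 0
  · exact ⟨1, 0, Or.inl one_ne_zero, by simp [ha]⟩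
  · refine ⟨-b + √(b * b - a * c), a, Or.inr ha, ?_⟩
    have hs := Real.sq_sqrt (show 0 ≤ b * b - a * c by linarith)
    linear_combination a * hs

theorem det_nonpos_of_isotropic {a b c p q : ℝ} (hpq : p ≠ 0 ∨ q ≠ 0)
    (h : a * p ^ 2 + 2 * b * p * q + c * q ^ 2 = 0) : a * c - b * b ≤ 0 := by
  by_contra! hd
  rcases hpq with hp | hq
  · have h1 : (c * q + b * p) ^ 2 + (a * c - b * b) * p ^ 2 = 0 := by linear_combination c * h
    have : 0 < p ^ 2 := by positivity
    nlinarith [sq_nonneg (c * q + b * p), mul_pos hd this]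
  · have h1 : (a * p + b * q) ^ 2 + (a * c - b * b) * q ^ 2 = 0 := by linear_combination a * h
    have : 0 < q ^ 2 := by positivity
    nlinarith [sq_nonneg (a * p + b * q), mul_pos hd this]

/-- Let `S` be a symmetric invertible real 2×2 matrix and `ω` the symplectic
form on `V₆` with `ω(vᵢ, vⱼ) = ω(wᵢ, wⱼ) = 0`, `ω(uᵢ, vⱼ) = ω(uᵢ, wⱼ) = 0`,
`ω(u₁, u₂) ≠ 0` and `ω(vᵢ, wⱼ) = Sᵢⱼ`. Let `X, Y` be the endomorphisms with `X uᵢ = vᵢ`,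
`Y uᵢ = wᵢ` vanishing on `v₁, v₂, w₁, w₂`. Then there exists a Lagrangian subspace of
`(V₆, ω)` invariant under `X` and `Y` if and only if `det S < 0`. -/
theorem stmt_11 (S : Matrix (Fin 2) (Fin 2) ℝ) (hsymm : S.IsSymm) (hdet : S.det ≠ 0)
    (ω : V6 →ₗ[ℝ] V6 →ₗ[ℝ] ℝ)
    (halt : ∀ x : V6, ω x x = 0)
    (hvv : ∀ i j, ω (vv i) (vv j) = 0)
    (hww : ∀ i j, ω (ww i) (ww j) = 0)
    (huv : ∀ i j, ω (uu i) (vv j) = 0)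
    (huw : ∀ i j, ω (uu i) (ww j) = 0)
    (huu : ω (uu 0) (uu 1) ≠ 0)
    (hvw : ∀ i j, ω (vv i) (ww j) = S i j)
    (X Y : V6 →ₗ[ℝ] V6)
    (hXu : ∀ i, X (uu i) = vv i) (hYu : ∀ i, Y (uu i) = ww i)
    (hXv : ∀ i, X (vv i) = 0) (hXw : ∀ i, X (ww i) = 0)
    (hYv : ∀ i, Y (vv i) = 0) (hYw : ∀ i, Y (ww i) = 0) :
    (∃ a : Submodule ℝ V6,
        (∀ x ∈ a, ∀ y ∈ a, ω x y = 0) ∧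
        Module.finrank ℝ a = 3 ∧
        (∀ x ∈ a, X x ∈ a) ∧ (∀ x ∈ a, Y x ∈ a)) ↔
      S.det < 0 := by
  have hform := symplectic_apply S ω halt hvv hww huv huw hvw
  have hS : S 1 0 = S 0 1 := hsymm.apply 0 1
  have hXx : ∀ x, X x = x 0 • vv 0 + x 1 • vv 1 := fun x => by
    conv_lhs => rw [V6_expand x]
    simp only [map_add, map_smul, hXu, hXv, hXw, smul_zero, add_zero]
  have hYx : ∀ x, Y x = x 0 • ww 0 + x 1 • ww 1 := fun x => by
    conv_lhs => rw [V6_expand x]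
    simp only [map_add, map_smul, hYu, hYv, hYw, smul_zero, add_zero]
  have hq : ∀ p q : ℝ, ω (p • vv 0 + q • vv 1) (p • ww 0 + q • ww 1) =
      S 0 0 * p ^ 2 + 2 * S 0 1 * p * q + S 1 1 * q ^ 2 := fun p q => by
    simp only [map_add, map_smul, LinearMap.add_apply, LinearMap.smul_apply, smul_eq_mul, hvw, hS]
    ring
  rw [Matrix.det_fin_two, hS] at hdet ⊢
  constructor
  · rintro ⟨a, hiso, hdim, hXa, hYa⟩
    obtain ⟨x, hxa, hx⟩ : ∃ x ∈ a, x 0 ≠ 0 ∨ x 1 ≠ 0 := by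
      by_contra! hcon
      have hrefl : ω.IsRefl := fun x y h => by rw [alternating_swap ω halt, h, neg_zero]
      have hnd : ω.Nondegenerate := by
        rw [hrefl.nondegenerate_iff_separatingLeft]
        intro x hx
        have e := fun y => (hform x y).symm.trans (hx y)
        have e0 := e (uu 0)
        have e1 := e (uu 1)
        have e2 := e (vv 0)
        have e3 := e (vv 1)
        have e4 := e (ww 0)
        have e5 := e (ww 1)
        simp [uu, vv, ww, hS] at e0 e1 e2 e3 e4 e5
        have h0 : x 0 = 0 := e1.resolve_left huu
        have h1 : x 1 = 0 := e0.resolve_left huu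
        have h2 : x 2 = 0 := (mul_eq_zero.mp (by
          linear_combination S 1 1 * e4 - S 0 1 * e5 :
            (S 0 0 * S 1 1 - S 0 1 * S 0 1) * x 2 = 0)).resolve_left hdet
        have h3 : x 3 = 0 := (mul_eq_zero.mp (by
          linear_combination S 0 0 * e5 - S 0 1 * e4 :
            (S 0 0 * S 1 1 - S 0 1 * S 0 1) * x 3 = 0)).resolve_left hdet
        have h4 : x 4 = 0 := (mul_eq_zero.mp (by
          linear_combination -S 1 1 * e2 + S 0 1 * e3 :
            (S 0 0 * S 1 1 - S 0 1 * S 0 1) * x 4 = 0)).resolve_left hdet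
        have h5 : x 5 = 0 := (mul_eq_zero.mp (by
          linear_combination -S 0 0 * e3 + S 0 1 * e2 :
            (S 0 0 * S 1 1 - S 0 1 * S 0 1) * x 5 = 0)).resolve_left hdet
        ext i
        fin_cases i <;> assumption
      have hfin := LinearMap.BilinForm.finrank_orthogonal hnd a
      rw [hdim, Module.finrank_fin_fun] at hfin
      have hle : a ≤ LinearMap.BilinForm.orthogonal ω a := fun y hy x hx => hiso x hx y hy
      have heq := Submodule.eq_of_le_of_finrank_eq hle (by rw [hdim, hfin])
      have hu : uu 0 ∈ a := by
        rw [heq]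
        intro x hx
        obtain ⟨h0, h1⟩ := hcon x hx
        change ω x (uu 0) = 0
        rw [hform, h0, h1]
        simp [uu]
      exact absurd (hcon _ hu).1 (by simp [uu])
    have h := hiso _ (hXa x hxa) _ (hYa x hxa)
    rw [hXx, hYx, hq] at h
    exact lt_of_le_of_ne (det_nonpos_of_isotropic hx h) hdet
  · intro hneg
    obtain ⟨p, q, hpq, h⟩ := exists_isotropic_of_det_neg hneg
    let f : Fin 3 → V6 :=
      ![p • uu 0 + q • uu 1, p • vv 0 + q • vv 1, p • ww 0 + q • ww 1]
    have hf : LinearIndependent ℝ f := by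
      rw [Fintype.linearIndependent_iff]
      intro g hg
      have e := fun i => congrFun hg i
      have e0 := e 0
      have e1 := e 1
      have e2 := e 2
      have e3 := e 3
      have e4 := e 4
      have e5 := e 5
      simp [f, Fin.sum_univ_three, uu, vv, ww] at e0 e1 e2 e3 e4 e5
      intro i
      fin_cases i <;> simp <;> grind
    have hmem : ∀ x ∈ Submodule.span ℝ (Set.range f),
        ∃ r s t : ℝ, x = r • f 0 + s • f 1 + t • f 2 := fun x hx => by
      obtain ⟨c, rfl⟩ := (Submodule.mem_span_range_iff_exists_fun ℝ).mp hx
      exact ⟨c 0, c 1, c 2, Fin.sum_univ_three _⟩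
    have hfm : ∀ i, f i ∈ Submodule.span ℝ (Set.range f) :=
      fun i => Submodule.subset_span ⟨i, rfl⟩
    refine ⟨Submodule.span ℝ (Set.range f), ?_, ?_, ?_, ?_⟩
    · intro x hx y hy
      obtain ⟨r, s, t, rfl⟩ := hmem x hx
      obtain ⟨r', s', t', rfl⟩ := hmem y hy
      rw [hform]
      simp [f, uu, vv, ww, hS]
      linear_combination (s * t' - s' * t) * h
    · rw [finrank_span_eq_card hf, Fintype.card_fin]
    · intro x hx
      obtain ⟨r, s, t, rfl⟩ := hmem x hx
      convert Submodule.smul_mem _ r (hfm 1) using 1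
      rw [hXx]
      simp [f, uu, vv, ww, mul_smul]
    · intro x hx
      obtain ⟨r, s, t, rfl⟩ := hmem x hx
      convert Submodule.smul_mem _ r (hfm 2) using 1
      rw [hYx]
      simp [f, uu, vv, ww, mul_smul]

end
end

section
/- Let (g, ω) be a symplectic Lie algebra over a field of characteristic 0. Then for all i ≥ 0, the term C^i g of the descending central series is ω-orthogonal to the term C_i g of the ascending central series: ω(x, z) = 0 for all x ∈ C^i g and z ∈ C_i g. In particular, ω(x, z) = 0 for all x ∈ [g, g] and all z in the center Z(g). -/
/-- Bracketing with the `i`-th term of the lower central series lowers the upper central series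
of a Lie module by `i + 1`. -/
theorem LieSubmodule.lie_mem_ucs_of_mem_lowerCentralSeries {R L M : Type*} [CommRing R]
    [LieRing L] [LieAlgebra R L] [AddCommGroup M] [Module R M] [LieRingModule L M]
    [LieModule R L M] (N : LieSubmodule R L M) (i j : ℕ) {x : L} {z : M}
    (hx : x ∈ LieModule.lowerCentralSeries R L L i) (hz : z ∈ N.ucs (j + i + 1)) :
    ⁅x, z⁆ ∈ N.ucs j := by
  induction i generalizing j x z with
  | zero =>
    rw [add_zero, ucs_succ, mem_normalizer] at hz
    exact hz x
  | succ i ih =>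
    rw [LieModule.lowerCentralSeries_succ, ← mem_toSubmodule,
      lieIdeal_oper_eq_linear_span'] at hx
    induction hx using Submodule.span_induction with
    | mem x h =>
      obtain ⟨u, -, v, hv, rfl⟩ := h
      rw [lie_lie]
      have hvz : ⁅v, z⁆ ∈ N.ucs (j + 1) := ih (j + 1) hv (by convert hz using 2; omega)
      have hvuz : ⁅v, ⁅u, z⁆⁆ ∈ N.ucs j := by
        rw [ucs_succ, mem_normalizer] at hz
        exact ih j hv (hz u)
      rw [ucs_succ, mem_normalizer] at hvz
      exact sub_mem (hvz u) hvuz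
    | zero => simp
    | add x y _ _ hx hy => rw [add_lie]; exact add_mem hx hy
    | smul c x _ hx => rw [smul_lie]; exact SMulMemClass.smul_mem c hx

/-- For a closed alternating form on a Lie algebra, the terms of the lower and upper central
series of equal index are orthogonal. -/
theorem LieAlgebra.apply_lowerCentralSeries_ucs_eq_zero {R L : Type*} [CommRing R]
    [LieRing L] [LieAlgebra R L] (ω : L →ₗ[R] L →ₗ[R] R) (halt : ω.IsAlt)
    (hclosed : ∀ u v w : L, ω ⁅u, v⁆ w + ω ⁅w, u⁆ v + ω ⁅v, w⁆ u = 0) (i : ℕ) {x z : L}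
    (hx : x ∈ LieModule.lowerCentralSeries R L L i) (hz : z ∈ (⊥ : LieIdeal R L).ucs i) :
    ω x z = 0 := by
  induction i generalizing x z with
  | zero =>
    rw [LieSubmodule.ucs_zero, LieSubmodule.mem_bot] at hz
    rw [hz, map_zero]
  | succ i ih =>
    rw [LieModule.lowerCentralSeries_succ, ← LieSubmodule.mem_toSubmodule,
      LieSubmodule.lieIdeal_oper_eq_linear_span'] at hx
    induction hx using Submodule.span_induction with
    | mem x h =>
      obtain ⟨u, -, v, hv, rfl⟩ := h
      have hvz : ⁅v, z⁆ = 0 := by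
        rw [← LieSubmodule.mem_bot (R := R) (L := L), ← LieSubmodule.ucs_zero (N := ⊥)]
        exact LieSubmodule.lie_mem_ucs_of_mem_lowerCentralSeries ⊥ i 0 hv (by rwa [zero_add])
      rw [LieSubmodule.ucs_succ, LieSubmodule.mem_normalizer] at hz
      have huz : ω ⁅z, u⁆ v = 0 := by
        rw [← halt.neg, ← lie_skew, map_neg, neg_neg]
        exact ih hv (hz u)
      simpa [hvz, huz] using hclosed u v z
    | zero => simp
    | add x y _ _ hx hy => simp [hx, hy]
    | smul c x _ hx => simp [hx]

/-- In a symplectic Lie algebra `(g, ω)`, each term `C^i g` of the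
descending central series is `ω`-orthogonal to the corresponding term `C_i g` of the
ascending central series. In particular `[g, g]` is orthogonal to the center of `g`. -/
theorem stmt_13 {k : Type*} [Field k] [CharZero k]
    {g : Type*} [LieRing g] [LieAlgebra k g] [Module.Finite k g]
    (ω : g →ₗ[k] g →ₗ[k] k)
    (halt : ∀ u : g, ω u u = 0)
    (hnondeg : ∀ u : g, (∀ v : g, ω u v = 0) → u = 0)
    (hclosed : ∀ u v w : g, ω ⁅u, v⁆ w + ω ⁅w, u⁆ v + ω ⁅v, w⁆ u = 0) :
    (∀ i : ℕ, ∀ x ∈ LieModule.lowerCentralSeries k g g i,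
      ∀ z ∈ (⊥ : LieIdeal k g).ucs i, ω x z = 0) ∧
    (∀ x ∈ LieModule.lowerCentralSeries k g g 1, ∀ z ∈ LieAlgebra.center k g, ω x z = 0) := by
  have h (i : ℕ) (x : g) (hx : x ∈ LieModule.lowerCentralSeries k g g i) (z : g)
      (hz : z ∈ (⊥ : LieIdeal k g).ucs i) : ω x z = 0 :=
    LieAlgebra.apply_lowerCentralSeries_ucs_eq_zero ω halt hclosed i hx hz
  refine ⟨h, fun x hx z hz => h 1 x hx z ?_⟩
  rwa [LieSubmodule.ucs_bot_one]
end

section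
/- Let (g, ω) be a symplectic Lie algebra over a field of characteristic 0 whose underlying Lie algebra is nilpotent of nilpotency class k. Then: (1) for all i, j with i + j ≥ k, ω(x, y) = 0 for all x ∈ C^i g and y ∈ C^j g; (2) for all i with 2i ≥ k, the ideal C^i g is isotropic; (3) if k = 2ℓ is even, then (g, ω) has an isotropic ideal of dimension at least ℓ; (4) if k = 2ℓ − 1 is odd, then (g, ω) has an isotropic ideal of dimension at least ℓ. -/
section LowerCentralSeries

open LieModule

variable {k : Type*} [CommRing k] {g : Type*} [LieRing g] [LieAlgebra k g]

theorem lowerCentralSeries_succ_le_of_forall_lie_mem (P : Submodule k g) (i : ℕ)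
    (h : ∀ a : g, ∀ b ∈ lowerCentralSeries k g g i, ⁅a, b⁆ ∈ P) :
    (lowerCentralSeries k g g (i + 1)).toSubmodule ≤ P := by
  rw [lowerCentralSeries_succ, LieSubmodule.lieIdeal_oper_eq_linear_span', Submodule.span_le]
  rintro _ ⟨a, -, b, hb, rfl⟩
  exact h a b hb

theorem lie_mem_lowerCentralSeries_succ {i : ℕ} (a : g) {b : g}
    (hb : b ∈ lowerCentralSeries k g g i) : ⁅a, b⁆ ∈ lowerCentralSeries k g g (i + 1) := by
  rw [lowerCentralSeries_succ]
  exact LieSubmodule.lie_mem_lie (LieSubmodule.mem_top a) hb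

theorem lie_mem_lowerCentralSeries_add {i j : ℕ} {x y : g}
    (hx : x ∈ lowerCentralSeries k g g i) (hy : y ∈ lowerCentralSeries k g g j) :
    ⁅x, y⁆ ∈ lowerCentralSeries k g g (i + j + 1) := by
  induction i generalizing j x y with
  | zero => simpa using lie_mem_lowerCentralSeries_succ x hy
  | succ i ih =>
    refine lowerCentralSeries_succ_le_of_forall_lie_mem
      ((lowerCentralSeries k g g (i + 1 + j + 1)).toSubmodule.comap
        ((toEnd k g g : g →ₗ[k] Module.End k g).flip y)) i (fun a b hb => ?_) hx
    change ⁅⁅a, b⁆, y⁆ ∈ lowerCentralSeries k g g (i + 1 + j + 1)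
    rw [lie_lie]
    refine sub_mem ?_ ?_
    · rw [show i + 1 + j + 1 = i + j + 1 + 1 by omega]
      exact lie_mem_lowerCentralSeries_succ a (ih hb hy)
    · rw [show i + 1 + j + 1 = i + (j + 1) + 1 by omega]
      exact ih hb (lie_mem_lowerCentralSeries_succ a hy)

theorem lowerCentralSeries_eq_of_succ_eq {i : ℕ}
    (h : lowerCentralSeries k g g (i + 1) = lowerCentralSeries k g g i) (n : ℕ) :
    lowerCentralSeries k g g (i + n) = lowerCentralSeries k g g i := by
  induction n with
  | zero => rfl
  | succ n ih => rw [← add_assoc, lowerCentralSeries_succ, ih, ← lowerCentralSeries_succ, h]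

theorem lowerCentralSeries_succ_lt {c : ℕ} (hc : lowerCentralSeries k g g c = ⊥)
    (hcmin : ∀ m : ℕ, lowerCentralSeries k g g m = ⊥ → c ≤ m) {i : ℕ} (hi : i < c) :
    lowerCentralSeries k g g (i + 1) < lowerCentralSeries k g g i := by
  refine lt_of_le_of_ne (antitone_lowerCentralSeries k g g i.le_succ) fun h => ?_
  have hconst := lowerCentralSeries_eq_of_succ_eq h (c - i)
  rw [Nat.add_sub_cancel' hi.le, hc] at hconst
  exact absurd (hcmin i hconst.symm) (by omega)

end LowerCentralSeries

theorem le_finrank_lowerCentralSeries {k : Type*} [Field k] {g : Type*} [LieRing g]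
    [LieAlgebra k g] [Module.Finite k g] {c : ℕ}
    (hc : LieModule.lowerCentralSeries k g g c = ⊥)
    (hcmin : ∀ m : ℕ, LieModule.lowerCentralSeries k g g m = ⊥ → c ≤ m) {i n : ℕ}
    (h : i + n = c) :
    n ≤ Module.finrank k (LieModule.lowerCentralSeries k g g i).toSubmodule := by
  induction n generalizing i with
  | zero => exact Nat.zero_le _
  | succ n ih =>
    exact (ih (i := i + 1) (by omega)).trans_lt
      (Submodule.finrank_lt_finrank_of_lt (lowerCentralSeries_succ_lt hc hcmin (by omega)))

/-- In a symplectic Lie algebra, `C^i g` and `C^j g` are orthogonal as soon as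
`C^(i + j) g` vanishes. -/
theorem orthogonal_lowerCentralSeries {k : Type*} [CommRing k] {g : Type*} [LieRing g]
    [LieAlgebra k g] (ω : g →ₗ[k] g →ₗ[k] k)
    (halt : ω.IsAlt)
    (hclosed : ∀ u v w : g, ω ⁅u, v⁆ w + ω ⁅w, u⁆ v + ω ⁅v, w⁆ u = 0) {c : ℕ}
    (hc : LieModule.lowerCentralSeries k g g c = ⊥) {i j : ℕ} (hij : c ≤ i + j) {x y : g}
    (hx : x ∈ LieModule.lowerCentralSeries k g g i)
    (hy : y ∈ LieModule.lowerCentralSeries k g g j) : ω x y = 0 := by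
  have hzero : ∀ {m : ℕ} {z : g}, c ≤ m → z ∈ LieModule.lowerCentralSeries k g g m → z = 0 := by
    intro m z hm hz
    simpa [hc] using LieModule.antitone_lowerCentralSeries k g g hm hz
  induction i generalizing j x y with
  | zero => simp [hzero (by omega) hy]
  | succ i ih =>
    refine lowerCentralSeries_succ_le_of_forall_lie_mem (LinearMap.ker (ω.flip y)) i
      (fun a b hb => ?_) hx
    have hya : ω ⁅y, a⁆ b = 0 := by
      rw [← halt.neg, ← lie_skew, map_neg, neg_neg]
      exact ih (by omega) hb (lie_mem_lowerCentralSeries_succ a hy)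
    have hby : ⁅b, y⁆ = 0 := hzero (by omega) (lie_mem_lowerCentralSeries_add hb hy)
    simpa [hya, hby] using hclosed a b y


/-- Let `(g, ω)` be a symplectic Lie algebra with `g` nilpotent of
nilpotency class `c`. Then:
(1) `C^i g ⊥ C^j g` whenever `i + j ≥ c`;
(2) `C^i g` is an isotropic ideal whenever `2i ≥ c`;
(3) if `c = 2ℓ` then there is an isotropic ideal of dimension at least `ℓ`;
(4) if `c = 2ℓ - 1` then there is an isotropic ideal of dimension at least `ℓ`. -/
theorem stmt_14 {k : Type*} [Field k] [CharZero k]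
    {g : Type*} [LieRing g] [LieAlgebra k g] [Module.Finite k g]
    (ω : g →ₗ[k] g →ₗ[k] k)
    (halt : ∀ u : g, ω u u = 0)
    (hnondeg : ∀ u : g, (∀ v : g, ω u v = 0) → u = 0)
    (hclosed : ∀ u v w : g, ω ⁅u, v⁆ w + ω ⁅w, u⁆ v + ω ⁅v, w⁆ u = 0)
    (c : ℕ)
    (hc : LieModule.lowerCentralSeries k g g c = ⊥)
    (hcmin : ∀ m : ℕ, LieModule.lowerCentralSeries k g g m = ⊥ → c ≤ m) :
    (∀ i j : ℕ, c ≤ i + j →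
      ∀ x ∈ LieModule.lowerCentralSeries k g g i,
      ∀ y ∈ LieModule.lowerCentralSeries k g g j, ω x y = 0) ∧
    (∀ i : ℕ, c ≤ 2 * i →
      ∀ x ∈ LieModule.lowerCentralSeries k g g i,
      ∀ y ∈ LieModule.lowerCentralSeries k g g i, ω x y = 0) ∧
    (∀ l : ℕ, c = 2 * l →
      ∃ j : LieIdeal k g, (∀ x ∈ j, ∀ y ∈ j, ω x y = 0) ∧
        l ≤ Module.finrank k j.toSubmodule) ∧
    (∀ l : ℕ, c + 1 = 2 * l →
      ∃ j : LieIdeal k g, (∀ x ∈ j, ∀ y ∈ j, ω x y = 0) ∧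
        l ≤ Module.finrank k j.toSubmodule) := by
  have horth {i j : ℕ} (hij : c ≤ i + j) {x y : g}
      (hx : x ∈ LieModule.lowerCentralSeries k g g i)
      (hy : y ∈ LieModule.lowerCentralSeries k g g j) : ω x y = 0 :=
    orthogonal_lowerCentralSeries ω halt hclosed hc hij hx hy
  refine ⟨fun i j hij x hx y hy => horth hij hx hy,
    fun i hi x hx y hy => horth (by omega) hx hy,
    fun l hl => ⟨LieModule.lowerCentralSeries k g g l,
      fun x hx y hy => horth (by omega) hx hy,
      le_finrank_lowerCentralSeries hc hcmin (by omega)⟩, ?_⟩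
  intro l hl
  obtain ⟨m, rfl⟩ : ∃ m, l = m + 1 := ⟨l - 1, by omega⟩
  have hlt := lowerCentralSeries_succ_lt hc hcmin (i := m) (by omega)
  obtain ⟨x, hx, hx'⟩ := SetLike.exists_of_lt hlt
  have hle : (LieModule.lowerCentralSeries k g g (m + 1)).toSubmodule ⊔ k ∙ x ≤
      (LieModule.lowerCentralSeries k g g m).toSubmodule :=
    sup_le hlt.le ((Submodule.span_singleton_le_iff_mem _ _).2 hx)
  refine ⟨{ (LieModule.lowerCentralSeries k g g (m + 1)).toSubmodule ⊔ k ∙ x with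
    lie_mem := fun {a b} hb =>
      Submodule.mem_sup_left (lie_mem_lowerCentralSeries_succ a (hle hb)) }, ?_, ?_⟩
  · intro u hu v hv
    obtain ⟨u', hu', s, hs, rfl⟩ := Submodule.mem_sup.1 hu
    obtain ⟨v', hv', t, ht, rfl⟩ := Submodule.mem_sup.1 hv
    obtain ⟨a, rfl⟩ := Submodule.mem_span_singleton.1 hs
    obtain ⟨b, rfl⟩ := Submodule.mem_span_singleton.1 ht
    simp [horth (by omega) hu' hv', horth (by omega) hu' hx, horth (by omega) hx hv', halt x]
  · have hdim := le_finrank_lowerCentralSeries hc hcmin (i := m + 1) (n := m) (by omega)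
    refine hdim.trans_lt (Submodule.finrank_lt_finrank_of_lt (left_lt_sup.2 fun h => hx' ?_))
    exact (Submodule.span_singleton_le_iff_mem _ _).1 h
end

section
/- Let (g, ω) be a two-step nilpotent symplectic Lie algebra over a field of characteristic 0, i.e. [g, [g, g]] = 0. Then: (1) the commutator ideal [g, g] is an isotropic subspace of (g, ω); (2) (g, ω) has a Lagrangian ideal. -/
open Module

/-- In a finite-dimensional symplectic vector space, every isotropic subspace is contained in a
Lagrangian subspace. -/
theorem exists_lagrangian_ge_s15 {k V : Type*} [Field k] [AddCommGroup V] [Module k V]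
    [Module.Finite k V] (B : LinearMap.BilinForm k V) (hB : B.IsAlt) (hnd : B.Nondegenerate)
    (D : Submodule k V) (hD : ∀ x ∈ D, ∀ y ∈ D, B x y = 0) :
    ∃ W : Submodule k V, D ≤ W ∧ (∀ x ∈ W, ∀ y ∈ W, B x y = 0) ∧
      2 * finrank k W = finrank k V := by
  obtain ⟨W, hDW, hW⟩ := exists_maximal_ge_of_wellFoundedGT
    (fun W : Submodule k V => ∀ x ∈ W, ∀ y ∈ W, B x y = 0) D hD
  refine ⟨W, hDW, hW.prop, ?_⟩
  have horth : B.orthogonal W = W := by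
    refine le_antisymm (fun x hx => ?_) fun x hx y hy => hW.prop y hy x hx
    have hWx : ∀ w ∈ W, B w x = 0 := hx
    have hxW : ∀ w ∈ W, B x w = 0 := fun w hw => hB.isRefl _ _ (hWx w hw)
    refine hW.le_of_ge (y := W ⊔ Submodule.span k {x}) ?_ le_sup_left
      (Submodule.mem_sup_right (Submodule.mem_span_singleton_self x))
    intro u hu v hv
    obtain ⟨a, ha, _, hb, rfl⟩ := Submodule.mem_sup.mp hu
    obtain ⟨c, hc, _, hd, rfl⟩ := Submodule.mem_sup.mp hv
    obtain ⟨r, rfl⟩ := Submodule.mem_span_singleton.mp hb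
    obtain ⟨t, rfl⟩ := Submodule.mem_span_singleton.mp hd
    simp [hW.prop a ha c hc, hWx a ha, hxW c hc, hB.self_eq_zero x]
  have hrank := LinearMap.BilinForm.finrank_orthogonal hnd W
  rw [horth] at hrank
  have := Submodule.finrank_le W
  omega


/-- Let `(g, ω)` be a two-step nilpotent symplectic Lie algebra,
i.e. `[g, [g, g]] = 0`. Then (1) the commutator ideal `[g, g]` is isotropic, and
(2) `(g, ω)` has a Lagrangian ideal. -/
theorem stmt_15 {k : Type*} [Field k] [CharZero k]
    {g : Type*} [LieRing g] [LieAlgebra k g] [Module.Finite k g]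
    (ω : g →ₗ[k] g →ₗ[k] k)
    (halt : ∀ u : g, ω u u = 0)
    (hnondeg : ∀ u : g, (∀ v : g, ω u v = 0) → u = 0)
    (hclosed : ∀ u v w : g, ω ⁅u, v⁆ w + ω ⁅w, u⁆ v + ω ⁅v, w⁆ u = 0)
    (h2step : ∀ x y z : g, ⁅x, ⁅y, z⁆⁆ = 0) :
    (∀ x ∈ LieModule.lowerCentralSeries k g g 1,
      ∀ y ∈ LieModule.lowerCentralSeries k g g 1, ω x y = 0) ∧
    (∃ a : LieIdeal k g,
      (∀ x ∈ a, ∀ y ∈ a, ω x y = 0) ∧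
      2 * Module.finrank k a.toSubmodule = Module.finrank k g) := by
  have hiso : ∀ x ∈ LieModule.lowerCentralSeries k g g 1,
      ∀ y ∈ LieModule.lowerCentralSeries k g g 1, ω x y = 0 := by
    have hspan : (LieModule.lowerCentralSeries k g g 1).toSubmodule =
        Submodule.span k {z | ∃ x y : g, ⁅x, y⁆ = z} := by
      rw [LieModule.lowerCentralSeries_succ, LieSubmodule.lieIdeal_oper_eq_linear_span']
      simp
    intro x hx y hy
    rw [← LieSubmodule.mem_toSubmodule, hspan] at hx hy
    induction hx, hy using Submodule.span_induction₂ with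
    | mem_mem x y hx hy =>
      obtain ⟨a, b, rfl⟩ := hx
      obtain ⟨c, d, rfl⟩ := hy
      have hcentral : ⁅⁅c, d⁆, a⁆ = 0 := by rw [← lie_skew, h2step, neg_zero]
      simpa [hcentral, h2step] using hclosed a b ⁅c, d⁆
    | zero_left y hy => simp
    | zero_right x hx => simp
    | add_left x y z _ _ _ hx hy => simp [hx, hy]
    | add_right x y z _ _ _ hx hy => simp [hx, hy]
    | smul_left r x y _ _ h => simp [h]
    | smul_right r x y _ _ h => simp [h]
  refine ⟨hiso, ?_⟩
  have hAlt : LinearMap.BilinForm.IsAlt ω := halt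
  have hnd : LinearMap.BilinForm.Nondegenerate ω :=
    ⟨hnondeg, fun y hy => hnondeg y fun x => hAlt.isRefl _ _ (hy x)⟩
  obtain ⟨W, hDW, hW, hdim⟩ := exists_lagrangian_ge_s15 ω hAlt hnd
    (LieModule.lowerCentralSeries k g g 1).toSubmodule hiso
  refine ⟨{ W with lie_mem := fun {x m} _ => hDW ?_ }, hW, hdim⟩
  rw [LieSubmodule.mem_toSubmodule, LieModule.lowerCentralSeries_succ]
  exact LieSubmodule.lie_mem_lie (LieSubmodule.mem_top x) (LieSubmodule.mem_top m)
end
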